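/- arXiv:2505.05185 — 2 statements merged into one kernel-verified Lean document; each statement's English description precedes it below -/
import Mathlib

section
/- Let G=(V,E) be a connected undirected graph, p ∈ (0,1)^E, λ ∈ [0,1]^V, θ ∈ (0,1), and let μ = μ^RC_{E,p,λ}. For every U ⊆ E, the tilted distribution (θ^{-1}*μ) conditioned on the event {T : T ⊆ U} equals the random cluster distribution μ^RC_{U,p*,λ} on subsets of U with respect to the graph (V,U), where p*_e = p_e/(p_e + θ(1−p_e)) for each e ∈ U. That is, for every T ⊆ U, (θ^{-1}*μ)(T)/Σ_{T'⊆U}(θ^{-1}*μ)(T') = μ^RC_{U,p*,λ}(T). -/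
open Finset Real

open scoped Classical in
/-- Vertices `u,v` are adjacent via an edge of `S` (edge `e` has endpoints `ends e`). -/
def adjRel {V E : Type} (ends : E → V × V) (S : Finset E) (u v : V) : Prop :=
  ∃ e ∈ S, ends e = (u, v) ∨ ends e = (v, u)

open scoped Classical in
/-- The connected component of `v` in the graph `(V, S)`. -/
noncomputable def comp {V E : Type} [Fintype V] (ends : E → V × V) (S : Finset E) (v : V) :
    Finset V :=
  Finset.univ.filter (fun u => Relation.ReflTransGen (adjRel ends S) v u)

/-- The set of connected components of the graph `(V, S)`. -/
noncomputable def comps {V E : Type} [Fintype V] [DecidableEq V] (ends : E → V × V) (S : Finset E) :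
    Finset (Finset V) :=
  Finset.univ.image (comp ends S)

/-- The random cluster weight of `S ⊆ U` w.r.t. the graph `(V, U)`. -/
noncomputable def rcWeight {V E : Type} [Fintype V] [DecidableEq V] [DecidableEq E]
    (ends : E → V × V) (p : E → ℝ) (lam : V → ℝ) (U S : Finset E) : ℝ :=
  (∏ e ∈ S, p e) * (∏ e ∈ U \ S, (1 - p e)) * ∏ C ∈ comps ends S, (1 + ∏ v ∈ C, lam v)

/-- The random cluster distribution `μ^RC_{U,p,λ}` on subsets of `U`, w.r.t. the graph `(V, U)`. -/
noncomputable def rcProb {V E : Type} [Fintype V] [DecidableEq V] [DecidableEq E]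
    (ends : E → V × V) (p : E → ℝ) (lam : V → ℝ) (U S : Finset E) : ℝ :=
  if S ⊆ U then rcWeight ends p lam U S / ∑ T ∈ U.powerset, rcWeight ends p lam U T else 0

open scoped Classical in
/-- The Ising weight of `T ⊆ V`: product of `β_e` over monochromatic edges times
product of `λ_v` over `v ∈ T`. -/
noncomputable def isingWeight {V E : Type} [Fintype E] [DecidableEq V]
    (ends : E → V × V) (β : E → ℝ) (lam : V → ℝ) (T : Finset V) : ℝ :=
  (∏ e ∈ Finset.univ.filter (fun e : E => ((ends e).1 ∈ T ↔ (ends e).2 ∈ T)), β e) *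
    ∏ v ∈ T, lam v

/-- The Ising Gibbs distribution `μ^Ising_{β,λ}` on subsets of `V`. -/
noncomputable def isingProb {V E : Type} [Fintype V] [Fintype E] [DecidableEq V]
    (ends : E → V × V) (β : E → ℝ) (lam : V → ℝ) (T : Finset V) : ℝ :=
  isingWeight ends β lam T / ∑ T' : Finset V, isingWeight ends β lam T'

/-- The graph with edge endpoints `ends` is connected. -/
def GraphConnected {V E : Type} [Fintype E] (ends : E → V × V) : Prop :=
  ∀ u v : V, Relation.ReflTransGen (adjRel ends Finset.univ) u v

/-- The tilted distribution `(θ⁻¹ * μ)` conditioned on `{T : T ⊆ U}`: for `T ⊆ U` it assigns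
probability `θ^{-|T|}·μ(T) / ∑_{T'⊆U} θ^{-|T'|}·μ(T')`, and `0` otherwise. -/
noncomputable def tiltCond {E : Type} [Fintype E] [DecidableEq E]
    (θ : ℝ) (μ : Finset E → ℝ) (U T : Finset E) : ℝ :=
  if T ⊆ U then
    (θ ^ T.card)⁻¹ * μ T / ∑ T' ∈ U.powerset, (θ ^ T'.card)⁻¹ * μ T'
  else 0

/-- The tilted weight is a constant multiple of the random cluster weight with parameter `p*`. -/
theorem tilt_weight_aux {V E : Type} [Fintype V] [DecidableEq V]
    [Fintype E] [DecidableEq E]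
    (ends : E → V × V) (p : E → ℝ) (lam : V → ℝ)
    (hp : ∀ e, p e ∈ Set.Ioo (0 : ℝ) 1)
    (θ : ℝ) (hθ : 0 < θ) (U T : Finset E) (hT : T ⊆ U) :
    (θ ^ T.card)⁻¹ * rcWeight ends p lam Finset.univ T =
      ((∏ e ∈ U, (p e + θ * (1 - p e)) / θ) * ∏ e ∈ Finset.univ \ U, (1 - p e)) *
        rcWeight ends (fun e => p e / (p e + θ * (1 - p e))) lam U T := by
  have hD : ∀ e, 0 < p e + θ * (1 - p e) := fun e => by
    have h := hp e
    have := mul_pos hθ (sub_pos.2 h.2)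
    linarith [h.1]
  have h1 : (θ ^ T.card)⁻¹ * ∏ e ∈ T, p e =
      (∏ e ∈ T, (p e + θ * (1 - p e)) / θ) * ∏ e ∈ T, p e / (p e + θ * (1 - p e)) := by
    rw [← Finset.prod_mul_distrib, ← Finset.prod_const, ← Finset.prod_inv_distrib,
      ← Finset.prod_mul_distrib]
    refine Finset.prod_congr rfl fun e _ => ?_
    have := (hD e).ne'
    field_simp
  have h2 : ∏ e ∈ U \ T, (1 - p e) =
      (∏ e ∈ U \ T, (p e + θ * (1 - p e)) / θ) *
        ∏ e ∈ U \ T, (1 - p e / (p e + θ * (1 - p e))) := by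
    rw [← Finset.prod_mul_distrib]
    refine Finset.prod_congr rfl fun e _ => ?_
    have := (hD e).ne'
    rw [one_sub_div this, div_mul_div_comm, mul_comm θ (p e + _), mul_div_mul_left _ _ this,
      add_sub_cancel_left, mul_div_cancel_left₀ _ hθ.ne']
  have h3 : ∏ e ∈ Finset.univ \ T, (1 - p e) =
      (∏ e ∈ Finset.univ \ U, (1 - p e)) * ∏ e ∈ U \ T, (1 - p e) := by
    rw [← Finset.prod_union]
    · refine Finset.prod_congr ?_ fun _ _ => rfl
      ext e
      have := @hT e
      simp only [Finset.mem_sdiff, Finset.mem_union, Finset.mem_univ, true_and]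
      tauto
    · exact Finset.disjoint_left.2 fun e he he' =>
        (Finset.mem_sdiff.1 he).2 (Finset.mem_sdiff.1 he').1
  have h4 := Finset.prod_sdiff (f := fun e => (p e + θ * (1 - p e)) / θ) hT
  simp only [rcWeight]
  rw [← h4, h3, ← mul_assoc, ← mul_assoc, h1, h2]
  ring

/-- The tilting identity, for arbitrary nonnegative vertex weights (in particular `[0,1]`). -/
theorem tilted_rc_eq_rc_of_nonneg {V E : Type} [Fintype V] [DecidableEq V]
    [Fintype E] [DecidableEq E]
    (ends : E → V × V) (p : E → ℝ) (lam : V → ℝ)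
    (hp : ∀ e, p e ∈ Set.Ioo (0 : ℝ) 1) (hlam : ∀ v, 0 ≤ lam v)
    (θ : ℝ) (hθ : 0 < θ) (U T : Finset E) (hT : T ⊆ U) :
    tiltCond θ (rcProb ends p lam Finset.univ) U T =
      rcProb ends (fun e => p e / (p e + θ * (1 - p e))) lam U T := by
  have hD : ∀ e, 0 < p e + θ * (1 - p e) := fun e => by
    have h := hp e
    have := mul_pos hθ (sub_pos.2 h.2)
    linarith [h.1]
  have hw : ∀ S, 0 < rcWeight ends p lam Finset.univ S := fun S => by
    refine mul_pos (mul_pos (Finset.prod_pos fun e _ => (hp e).1)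
      (Finset.prod_pos fun e _ => sub_pos.2 (hp e).2)) (Finset.prod_pos fun C _ => ?_)
    have := Finset.prod_nonneg (s := C) fun v _ => hlam v
    linarith
  have hZ : 0 < ∑ S ∈ (Finset.univ : Finset E).powerset, rcWeight ends p lam Finset.univ S :=
    Finset.sum_pos (fun S _ => hw S) ⟨∅, by simp⟩
  have hK : 0 < (∏ e ∈ U, (p e + θ * (1 - p e)) / θ) * ∏ e ∈ Finset.univ \ U, (1 - p e) :=
    mul_pos (Finset.prod_pos fun e _ => div_pos (hD e) hθ)
      (Finset.prod_pos fun e _ => sub_pos.2 (hp e).2)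
  have key := tilt_weight_aux ends p lam hp θ hθ U
  set Z := ∑ S ∈ (Finset.univ : Finset E).powerset, rcWeight ends p lam Finset.univ S with hZd
  set K := (∏ e ∈ U, (p e + θ * (1 - p e)) / θ) * ∏ e ∈ Finset.univ \ U, (1 - p e)
  have key2 : ∀ S ⊆ U, (θ ^ S.card)⁻¹ * rcProb ends p lam Finset.univ S =
      (K / Z) * rcWeight ends (fun e => p e / (p e + θ * (1 - p e))) lam U S := fun S hS => by
    rw [rcProb, if_pos (Finset.subset_univ S), ← hZd, ← mul_div_assoc, key S hS]
    ring
  rw [tiltCond, if_pos hT, key2 T hT,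
    Finset.sum_congr rfl fun S hS => key2 S (Finset.mem_powerset.1 hS), ← Finset.mul_sum,
    mul_div_mul_left _ _ (div_pos hK hZ).ne', rcProb, if_pos hT]

/-- **Tilting the random cluster model.** For the random cluster distribution
`μ = μ^RC_{E,p,λ}` on a connected graph and any `U ⊆ E`, the tilted distribution `(θ⁻¹ * μ)`
conditioned on `{T : T ⊆ U}` is the random cluster distribution `μ^RC_{U,p*,λ}` on subsets of
`U` w.r.t. the graph `(V,U)`, where `p*_e = p_e/(p_e + θ(1-p_e))`. -/
theorem tilted_rc_eq_rc {V E : Type} [Fintype V] [DecidableEq V]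
    [Fintype E] [DecidableEq E] [Nonempty V]
    (ends : E → V × V) (hconn : GraphConnected ends)
    (p : E → ℝ) (lam : V → ℝ)
    (hp : ∀ e, p e ∈ Set.Ioo (0 : ℝ) 1) (hlam : ∀ v, lam v ∈ Set.Ico (0 : ℝ) 1)
    (θ : ℝ) (hθ : θ ∈ Set.Ioo (0 : ℝ) 1) :
    ∀ U T : Finset E, T ⊆ U →
      tiltCond θ (rcProb ends p lam Finset.univ) U T =
        rcProb ends (fun e => p e / (p e + θ * (1 - p e))) lam U T := by
  intro U T hT
  exact tilted_rc_eq_rc_of_nonneg ends p lam hp (fun v => (hlam v).1) θ hθ.1 U T hT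
end

section
/- Let G = (V,E) be a connected undirected graph with n = |V| ≥ 3 vertices and m = |E| edges, let p ∈ (0,1)^E and λ ∈ [0,1)^V, let ε ∈ (0,1/2], and suppose (1 − p_min)·log n ≤ min{e^{−40}·exp(−5·log(1/ε)/log n), (1 − λ_max)/27}. Let μ = μ^RC_{E,p,λ}, and let (X_t)_{t≥0} be the Glauber dynamics for μ whose initial state X_0 is formed by including each e ∈ E independently with probability μ_e^E. Then for any T^GD ≥ ⌈2m·(log m + log(4/ε))⌉, the law of X_{T^GD} satisfies d_TV(X_{T^GD}, μ) ≤ ε/2. -/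
open MeasureTheory Finset Real

/-- The marginal probability `μ_e^X = μ(X∪{e}) / (μ(X∪{e}) + μ(X\{e}))`. -/
noncomputable def marg {E : Type} [DecidableEq E] (μ : Finset E → ℝ) (X : Finset E) (e : E) : ℝ :=
  μ (insert e X) / (μ (insert e X) + μ (X.erase e))

/-- `pred es i f`: the largest `j < i` with `es j = f` (or `⊥` if none), i.e. `pred_i(f)`. -/
def pred {E : Type} [DecidableEq E] {T : ℕ} (es : Fin T → E) (i : Fin T) (f : E) :
    WithBot (Fin T) :=
  (Finset.univ.filter (fun j : Fin T => j < i ∧ es j = f)).max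

/-- `jlast es f`: the largest `j` with `es j = f` (or `⊥` if none), i.e. `j_f`. -/
def jlast {E : Type} [DecidableEq E] {T : ℕ} (es : Fin T → E) (f : E) : WithBot (Fin T) :=
  (Finset.univ.filter (fun j : Fin T => es j = f)).max

/-- The configuration `σ_i` built from the initial set `X'` and the previous-round values
`Yprev`:
`σ_i = {f : (pred_i(f) = ⊥ ∧ f ∈ X') ∨ (pred_i(f) = j ∧ Yprev j = 1)}`. -/
def sigmaConf {E : Type} [Fintype E] [DecidableEq E] {T : ℕ}
    (es : Fin T → E) (X' : E → Bool) (Yprev : Fin T → Bool) (i : Fin T) : Finset E :=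
  Finset.univ.filter
    (fun f => (WithBot.recBotCoe (X' f) (fun j => Yprev j) (pred es i f)) = true)

/-- The iterates `Y^t` of the parallel simulation:
`Y^0_i = 1[es i ∈ X']` and `Y^t_i = 1[R_i < μ_{e_i}^{σ^t_i}]` where `σ^t_i` is built from
`Y^{t-1}`. -/
noncomputable def Yiter {E : Type} [Fintype E] [DecidableEq E] {T : ℕ}
    (μ : Finset E → ℝ) (es : Fin T → E) (Rs : Fin T → ℝ) (X' : E → Bool) :
    ℕ → Fin T → Bool
  | 0 => fun i => X' (es i)
  | t + 1 => fun i =>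
      if Rs i < marg μ (sigmaConf es X' (Yiter μ es Rs X' t) i) (es i) then true else false

/-- The output `X^ALG` of the parallel simulation after `TPA` rounds. -/
noncomputable def XALG {E : Type} [Fintype E] [DecidableEq E] {T : ℕ}
    (μ : Finset E → ℝ) (es : Fin T → E) (Rs : Fin T → ℝ) (X' : E → Bool) (TPA : ℕ) :
    Finset E :=
  Finset.univ.filter
    (fun f =>
      (WithBot.recBotCoe (X' f) (fun j => Yiter μ es Rs X' TPA j) (jlast es f)) = true)

/-- The Glauber dynamics trajectory driven by the choices `es, Rs` from initial state `X0`: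
`X_{i+1} = X_i ∪ {e_i}` if `R_i < μ_{e_i}^{X_i}`, else `X_i ∖ {e_i}`. -/
noncomputable def glauber {E : Type} [DecidableEq E] {T : ℕ}
    (μ : Finset E → ℝ) (es : Fin T → E) (Rs : Fin T → ℝ) (X0 : Finset E) : ℕ → Finset E
  | 0 => X0
  | i + 1 =>
      if h : i < T then
        if Rs ⟨i, h⟩ < marg μ (glauber μ es Rs X0 i) (es ⟨i, h⟩) then
          insert (es ⟨i, h⟩) (glauber μ es Rs X0 i)
        else (glauber μ es Rs X0 i).erase (es ⟨i, h⟩)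
      else glauber μ es Rs X0 i

/-- The set `X' ⊆ E` encoded by the boolean function `g`. -/
def toSet {E : Type} [Fintype E] [DecidableEq E] (g : E → Bool) : Finset E :=
  Finset.univ.filter (fun f => g f = true)

/-- The probability measure governing the random choices of the parallel simulation:
`e_1,…,e_T` uniform in `E`, `R_1,…,R_T` uniform in `[0,1]`, and `X'` containing each `f ∈ E`
independently with probability `μ_f^E`; all independent. -/
noncomputable def simMeasure {E : Type} [Fintype E] [DecidableEq E] [MeasurableSpace E]
    (μ : Finset E → ℝ) (T : ℕ) :
    Measure ((Fin T → E) × (Fin T → ℝ) × (E → Bool)) :=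
  ∑ es : Fin T → E, ∑ g : E → Bool,
    ((Fintype.card E : ENNReal)⁻¹ ^ T *
        ENNReal.ofReal
          (∏ f : E, if g f then marg μ Finset.univ f else 1 - marg μ Finset.univ f)) •
      (Measure.pi (fun _ : Fin T => volume.restrict (Set.Icc (0 : ℝ) 1))).map
        (fun r => (es, r, g))

/-- The total variation distance between the laws of two random variables `X, Y` with values
in a finite type, under the measure `P`. -/
noncomputable def dTVrv {Ω α : Type} [MeasurableSpace Ω] [Fintype α]
    (P : Measure Ω) (X Y : Ω → α) : ℝ :=
  (1 / 2) * ∑ a : α, |(P (X ⁻¹' {a})).toReal - (P (Y ⁻¹' {a})).toReal|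

/-- The total variation distance between the law of a random variable `X` (under `P`) and a
distribution given by a density `ν` on a finite type. -/
noncomputable def dTVrvDist {Ω α : Type} [MeasurableSpace Ω] [Fintype α]
    (P : Measure Ω) (X : Ω → α) (ν : α → ℝ) : ℝ :=
  (1 / 2) * ∑ a : α, |(P (X ⁻¹' {a})).toReal - ν a|

/-- The coupling-with-stationary condition with parameter `η`: there is a good family `G` of
configurations such that (1) marginals contract in total variation between good configurations,
and (2) any random configuration whose coordinates are independently sampled with marginals of
the form `μ_f^{S(f)}` is good except with probability `η`. -/
def CouplingWithStationary {E : Type} [Fintype E] [DecidableEq E]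
    (μ : Finset E → ℝ) (η : ℝ) : Prop :=
  ∃ G : Finset (Finset E),
    (∀ X ∈ G, ∀ Y ∈ G,
        ∑ e : E, |marg μ X e - marg μ Y e| ≤ ((symmDiff X Y).card : ℝ) / 2) ∧
    (∀ S : E → Finset E,
        ∑ σ ∈ Finset.univ.filter (fun σ : Finset E => σ ∉ G),
            ∏ f : E, (if f ∈ σ then marg μ (S f) f else 1 - marg μ (S f) f) ≤ η)


/-! ### Graph connectivity -/

set_option linter.unusedSectionVars false
set_option linter.unusedVariables false

section GlauberProof

variable {V E : Type} [Fintype V] [DecidableEq V] [Fintype E] [DecidableEq E]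

lemma adjRel_symm' {ends : E → V × V} {S : Finset E} {u v : V} (h : adjRel ends S u v) :
    adjRel ends S v u := by
  obtain ⟨e, he, h⟩ := h
  exact ⟨e, he, h.symm⟩

/-- connectivity in `(V,S)` -/
abbrev Cn (ends : E → V × V) (S : Finset E) (u v : V) : Prop :=
  Relation.ReflTransGen (adjRel ends S) u v

lemma Cn.symm' {ends : E → V × V} {S : Finset E} {u v : V} (h : Cn ends S u v) :
    Cn ends S v u := by
  induction h with
  | refl => exact Relation.ReflTransGen.refl
  | tail _ h2 ih => exact Relation.ReflTransGen.head (adjRel_symm' h2) ih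

lemma Cn.mono' {ends : E → V × V} {S T : Finset E} (hST : S ⊆ T) {u v : V}
    (h : Cn ends S u v) : Cn ends T u v := by
  refine Relation.ReflTransGen.mono ?_ _ _ h
  rintro a b ⟨e, he, h⟩
  exact ⟨e, hST he, h⟩

lemma Cn.edge {ends : E → V × V} {S : Finset E} {e : E} (he : e ∈ S) :
    Cn ends S (ends e).1 (ends e).2 :=
  Relation.ReflTransGen.single ⟨e, he, Or.inl rfl⟩

lemma mem_comp' {ends : E → V × V} {S : Finset E} {u v : V} :
    u ∈ comp ends S v ↔ Cn ends S v u := by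
  simp [comp]

lemma self_mem_comp (ends : E → V × V) (S : Finset E) (v : V) : v ∈ comp ends S v :=
  mem_comp'.2 Relation.ReflTransGen.refl

lemma comp_mono {ends : E → V × V} {S T : Finset E} (hST : S ⊆ T) (v : V) :
    comp ends S v ⊆ comp ends T v := fun _ h => mem_comp'.2 ((mem_comp'.1 h).mono' hST)

lemma comp_eq_iff {ends : E → V × V} {S : Finset E} {u v : V} :
    comp ends S u = comp ends S v ↔ Cn ends S u v := by
  constructor
  · intro h
    have := self_mem_comp ends S v
    rw [← h] at this
    exact mem_comp'.1 this
  · intro h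
    ext w
    rw [mem_comp', mem_comp']
    exact ⟨fun h1 => h.symm'.trans h1, fun h1 => h.trans h1⟩

lemma Cn_insert {ends : E → V × V} {S : Finset E} {f : E} {s t : V} :
    Cn ends (insert f S) s t ↔ Cn ends S s t ∨
      (Cn ends S s (ends f).1 ∧ Cn ends S (ends f).2 t) ∨
      (Cn ends S s (ends f).2 ∧ Cn ends S (ends f).1 t) := by
  constructor
  · intro h
    induction h with
    | refl => exact Or.inl Relation.ReflTransGen.refl
    | @tail b c _ h2 ih =>
      obtain ⟨e, he, h2⟩ := h2
      rcases Finset.mem_insert.1 he with rfl | he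
      · rcases h2 with h2 | h2
        · rw [h2] at ih ⊢
          rcases ih with ih | ⟨ih1, ih2⟩ | ⟨ih1, ih2⟩
          · exact Or.inr (Or.inl ⟨ih, Relation.ReflTransGen.refl⟩)
          · exact Or.inr (Or.inl ⟨ih1, Relation.ReflTransGen.refl⟩)
          · exact Or.inl ih1
        · rw [h2] at ih ⊢
          rcases ih with ih | ⟨ih1, ih2⟩ | ⟨ih1, ih2⟩
          · exact Or.inr (Or.inr ⟨ih, Relation.ReflTransGen.refl⟩)
          · exact Or.inl ih1
          · exact Or.inr (Or.inr ⟨ih1, Relation.ReflTransGen.refl⟩)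
      · have hbc : Cn ends S b c := Relation.ReflTransGen.single ⟨e, he, h2⟩
        rcases ih with ih | ⟨ih1, ih2⟩ | ⟨ih1, ih2⟩
        · exact Or.inl (ih.trans hbc)
        · exact Or.inr (Or.inl ⟨ih1, ih2.trans hbc⟩)
        · exact Or.inr (Or.inr ⟨ih1, ih2.trans hbc⟩)
  · have hS : S ⊆ insert f S := Finset.subset_insert f S
    have hf : Cn ends (insert f S) (ends f).1 (ends f).2 := Cn.edge (Finset.mem_insert_self f S)
    rintro (h | ⟨h1, h2⟩ | ⟨h1, h2⟩)
    · exact h.mono' hS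
    · exact (h1.mono' hS).trans (hf.trans (h2.mono' hS))
    · exact (h1.mono' hS).trans (hf.symm'.trans (h2.mono' hS))

/-- the edges with exactly one end in `S` -/
def cutE (ends : E → V × V) (S : Finset V) : Finset E :=
  Finset.univ.filter (fun e => ¬ ((ends e).1 ∈ S ↔ (ends e).2 ∈ S))

lemma mem_cutE {ends : E → V × V} {S : Finset V} {e : E} :
    e ∈ cutE ends S ↔ ¬ ((ends e).1 ∈ S ↔ (ends e).2 ∈ S) := by simp [cutE]

lemma not_mem_cut_comp {ends : E → V × V} {Y : Finset E} {x : V} {e : E} (he : e ∈ Y) :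
    e ∉ cutE ends (comp ends Y x) := by
  rw [mem_cutE, not_not, mem_comp', mem_comp']
  have := Cn.edge (ends := ends) he
  exact ⟨fun h => h.trans this, fun h => h.trans this.symm'⟩

lemma comp_subset_of_cut {ends : E → V × V} {Y : Finset E} {x : V} {S : Finset V}
    (hx : x ∈ S) (h : ∀ e ∈ Y, e ∉ cutE ends S) : comp ends Y x ⊆ S := by
  intro y hy
  have hy := mem_comp'.1 hy
  induction hy with
  | refl => exact hx
  | tail h1 h2 ih =>
    obtain ⟨e, he, h2⟩ := h2
    have ih := ih (mem_comp'.2 h1)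
    have := h e he
    rw [mem_cutE, not_not] at this
    rcases h2 with h2 | h2 <;> rw [h2] at this
    · exact this.1 ih
    · exact this.2 ih

/-- bridges of `Y` in the component of `x` -/
noncomputable def brid (ends : E → V × V) (Y : Finset E) (x : V) : Finset E :=
  Y.filter (fun e => e ∈ cutE ends (comp ends (Y.erase e) x))

/-- the end of `e` far from `x` -/
noncomputable def farE (ends : E → V × V) (Y : Finset E) (x : V) (e : E) : V :=
  if (ends e).1 ∈ comp ends (Y.erase e) x then (ends e).2 else (ends e).1

lemma farE_inter {ends : E → V × V} {Y : Finset E} {x : V} {e e' : E}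
    (he : e ∈ brid ends Y x) (he' : e' ∈ brid ends Y x) (hne : e ≠ e')
    (hfar : farE ends Y x e ∉ comp ends (Y.erase e') x) :
    comp ends (Y.erase e') x ⊆ comp ends (Y.erase e) x := by
  have key : comp ends (Y.erase e') x ⊆ comp ends (Y.erase e') x ∩ comp ends (Y.erase e) x := by
    apply comp_subset_of_cut
    · simp [self_mem_comp]
    · intro g hg
      by_cases hge : g = e
      · subst hge
        have h1 := not_mem_cut_comp (ends := ends) (x := x) hg
        rw [mem_cutE, not_not] at h1 ⊢
        simp only [Finset.mem_inter]
        unfold farE at hfar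
        split_ifs at hfar <;> tauto
      · have h1 := not_mem_cut_comp (ends := ends) (x := x) hg
        have h2 : g ∈ Y.erase e := Finset.mem_erase.2 ⟨hge, Finset.mem_of_mem_erase hg⟩
        have h2 := not_mem_cut_comp (ends := ends) (x := x) h2
        rw [mem_cutE, not_not] at h1 h2 ⊢
        simp only [Finset.mem_inter]
        tauto
  exact key.trans Finset.inter_subset_right

lemma farE_not_mem {ends : E → V × V} {Y : Finset E} {x : V} {e : E}
    (he : e ∈ brid ends Y x) : farE ends Y x e ∉ comp ends (Y.erase e) x := by
  have := (Finset.mem_filter.1 he).2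
  rw [mem_cutE] at this
  unfold farE
  split_ifs with h <;> tauto

lemma farE_mem {ends : E → V × V} {Y : Finset E} {x : V} {e : E}
    (he : e ∈ brid ends Y x) : farE ends Y x e ∈ comp ends Y x := by
  have h1 := (Finset.mem_filter.1 he).2
  have h2 := not_mem_cut_comp (ends := ends) (x := x) (Finset.mem_filter.1 he).1
  have h3 := comp_mono (ends := ends) (Finset.erase_subset e Y) x
  rw [mem_cutE] at h1
  rw [mem_cutE, not_not] at h2
  unfold farE
  split_ifs with h
  · exact h2.1 (h3 h)
  · exact h2.2 (h3 (by tauto))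

lemma brid_ne {ends : E → V × V} {Y : Finset E} {x : V} {e e' : E}
    (he : e ∈ brid ends Y x) (hne : e ≠ e')
    (h : comp ends (Y.erase e) x = comp ends (Y.erase e') x) : False := by
  have h1 := Finset.mem_filter.1 he
  have h2 := h1.2
  rw [h] at h2
  exact not_mem_cut_comp (Finset.mem_erase.2 ⟨hne, h1.1⟩) h2

lemma brid_card_le (ends : E → V × V) (Y : Finset E) (x : V) :
    (brid ends Y x).card ≤ (comp ends Y x).card := by
  apply Finset.card_le_card_of_injOn (farE ends Y x)
  · intro e he
    exact farE_mem he
  · intro e he e' he' h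
    by_contra hne
    have h1 : farE ends Y x e ∉ comp ends (Y.erase e') x := h ▸ farE_not_mem he'
    have h2 : farE ends Y x e' ∉ comp ends (Y.erase e) x := h ▸ farE_not_mem he
    exact brid_ne he hne ((farE_inter he' he (Ne.symm hne) h2).antisymm
      (farE_inter he he' hne h1))

lemma brid_count (ends : E → V × V) (Y : Finset E) (x : V) (k : ℕ) :
    ((brid ends Y x).filter (fun e => (comp ends (Y.erase e) x).card ≤ k)).card ≤ 2 * k := by
  by_cases hN : (comp ends Y x).card ≤ 2 * k
  · exact (Finset.card_filter_le _ _).trans ((brid_card_le ends Y x).trans hN)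
  · have : ((brid ends Y x).filter (fun e => (comp ends (Y.erase e) x).card ≤ k)).card
        ≤ (Finset.Icc 1 k).card := by
      apply Finset.card_le_card_of_injOn (fun e => (comp ends (Y.erase e) x).card)
      · intro e he
        have he := Finset.mem_filter.1 he
        simp only [Finset.coe_Icc, Set.mem_Icc]
        exact ⟨Finset.card_pos.2 ⟨x, self_mem_comp _ _ _⟩, he.2⟩
      · intro e he e' he' h
        have he := Finset.mem_filter.1 he
        have he' := Finset.mem_filter.1 he'
        by_contra hne
        by_cases h1 : farE ends Y x e ∈ comp ends (Y.erase e') x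
        · by_cases h2 : farE ends Y x e' ∈ comp ends (Y.erase e) x
          · apply hN
            have key : comp ends Y x ⊆ comp ends (Y.erase e) x ∪ comp ends (Y.erase e') x := by
              apply comp_subset_of_cut
              · simp [self_mem_comp]
              · intro g hg
                have hg1 : g ≠ e → g ∉ cutE ends (comp ends (Y.erase e) x) := fun h =>
                  not_mem_cut_comp (Finset.mem_erase.2 ⟨h, hg⟩)
                have hg2 : g ≠ e' → g ∉ cutE ends (comp ends (Y.erase e') x) := fun h =>
                  not_mem_cut_comp (Finset.mem_erase.2 ⟨h, hg⟩)
                rw [mem_cutE, not_not] at hg1 hg2 ⊢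
                simp only [Finset.mem_union]
                by_cases hge : g = e
                · subst hge
                  have := hg2 hne
                  unfold farE at h1
                  split_ifs at h1 <;> tauto
                · by_cases hge' : g = e'
                  · subst hge'
                    have := hg1 hge
                    unfold farE at h2
                    split_ifs at h2 <;> tauto
                  · have := hg1 hge
                    have := hg2 hge'
                    tauto
            have := (Finset.card_le_card key).trans (Finset.card_union_le _ _)
            omega
          · have := farE_inter he'.1 he.1 (Ne.symm hne) h2
            exact brid_ne he.1 hne (Finset.eq_of_subset_of_card_le this h.ge)
        · have := farE_inter he.1 he'.1 hne h1
          exact brid_ne he.1 hne (Finset.eq_of_subset_of_card_le this h.le).symm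
    simp at this
    omega

/-- small spanning subset of the component -/
lemma exists_span (ends : E → V × V) (Y : Finset E) (x : V) :
    ∃ τ ⊆ Y, comp ends τ x = comp ends Y x ∧ τ.card ≤ (comp ends Y x).card := by
  classical
  obtain ⟨τ, hτ, hmin⟩ := Finset.exists_min_image
    (Y.powerset.filter (fun τ => comp ends τ x = comp ends Y x)) Finset.card
    ⟨Y, by simp⟩
  simp only [Finset.mem_filter, Finset.mem_powerset] at hτ hmin
  refine ⟨τ, hτ.1, hτ.2, ?_⟩
  have hb : τ = brid ends τ x := by
    ext e
    simp only [brid, Finset.mem_filter, iff_self_and]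
    intro he
    by_contra hcut
    have h1 : comp ends τ x ⊆ comp ends (τ.erase e) x := by
      apply comp_subset_of_cut (self_mem_comp _ _ _)
      intro g hg
      by_cases hge : g = e
      · exact hge ▸ hcut
      · exact not_mem_cut_comp (Finset.mem_erase.2 ⟨hge, hg⟩)
    have h2 := h1.antisymm (comp_mono (Finset.erase_subset e τ) x)
    have := hmin (τ.erase e) ⟨(Finset.erase_subset e τ).trans hτ.1, h2.symm.trans hτ.2⟩
    have := Finset.card_erase_lt_of_mem he
    omega
  rw [← hτ.2]
  calc τ.card = (brid ends τ x).card := congrArg _ hb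
    _ ≤ _ := brid_card_le ends τ x


/-! ### Marginals of the random cluster measure -/

/-- the correction factor for the edge `e` relative to `S` (not containing `e`) -/
noncomputable def K0 (ends : E → V × V) (lam : V → ℝ) (S : Finset E) (e : E) : ℝ :=
  open scoped Classical in
  if Cn ends S (ends e).1 (ends e).2 then 1 else
    (1 + ∏ v ∈ comp ends S (ends e).1, lam v) * (1 + ∏ v ∈ comp ends S (ends e).2, lam v) /
      (1 + (∏ v ∈ comp ends S (ends e).1, lam v) * ∏ v ∈ comp ends S (ends e).2, lam v)

lemma comp_insert_not {ends : E → V × V} {S : Finset E} {f : E} {s : V}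
    (h1 : s ∉ comp ends S (ends f).1) (h2 : s ∉ comp ends S (ends f).2) :
    comp ends (insert f S) s = comp ends S s := by
  ext w
  rw [mem_comp'] at h1 h2
  rw [mem_comp', mem_comp', Cn_insert]
  constructor
  · rintro (h | ⟨h, -⟩ | ⟨h, -⟩)
    · exact h
    · exact absurd h.symm' h1
    · exact absurd h.symm' h2
  · exact Or.inl

lemma comp_insert_fst (ends : E → V × V) (S : Finset E) (f : E) :
    comp ends (insert f S) (ends f).1 = comp ends S (ends f).1 ∪ comp ends S (ends f).2 := by
  ext w
  rw [mem_comp', Finset.mem_union, mem_comp', mem_comp', Cn_insert]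
  constructor
  · rintro (h | ⟨-, h⟩ | ⟨-, h⟩)
    · exact Or.inl h
    · exact Or.inr h
    · exact Or.inl h
  · rintro (h | h)
    · exact Or.inl h
    · exact Or.inr (Or.inl ⟨Relation.ReflTransGen.refl, h⟩)

lemma mem_comps {ends : E → V × V} {S : Finset E} {C : Finset V} :
    C ∈ comps ends S ↔ ∃ v, comp ends S v = C := by simp [comps]

lemma compsW_insert (ends : E → V × V) (lam : V → ℝ) (hlam : ∀ v, lam v ∈ Set.Ico (0 : ℝ) 1)
    (S : Finset E) (e : E) :
    ∏ C ∈ comps ends S, (1 + ∏ v ∈ C, lam v) =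
      K0 ends lam S e * ∏ C ∈ comps ends (insert e S), (1 + ∏ v ∈ C, lam v) := by
  have hnn : ∀ C : Finset V, 0 ≤ ∏ v ∈ C, lam v := fun C =>
    Finset.prod_nonneg fun v _ => (hlam v).1
  unfold K0
  split_ifs with h
  · rw [one_mul]
    have : comps ends (insert e S) = comps ends S := by
      unfold comps
      congr 1
      funext s
      ext w
      rw [mem_comp', mem_comp', Cn_insert]
      constructor
      · rintro (h1 | ⟨h1, h2⟩ | ⟨h1, h2⟩)
        · exact h1
        · exact h1.trans (h.trans h2)
        · exact h1.trans (h.symm'.trans h2)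
      · exact Or.inl
    rw [this]
  · set A := comp ends S (ends e).1 with hA
    set B := comp ends S (ends e).2 with hB
    have hAB : A ≠ B := fun hh => h (comp_eq_iff.1 hh)
    have hdisj : Disjoint A B := by
      rw [Finset.disjoint_left]
      intro w h1 h2
      exact h ((mem_comp'.1 h1).trans (mem_comp'.1 h2).symm')
    have hAm : A ∈ comps ends S := mem_comps.2 ⟨_, rfl⟩
    have hBm : B ∈ (comps ends S).erase A :=
      Finset.mem_erase.2 ⟨hAB.symm, mem_comps.2 ⟨_, rfl⟩⟩
    have hcomp : comps ends (insert e S) = insert (A ∪ B) (((comps ends S).erase A).erase B) := by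
      ext C
      rw [mem_comps, Finset.mem_insert, Finset.mem_erase, Finset.mem_erase, mem_comps]
      constructor
      · rintro ⟨s, rfl⟩
        by_cases hs : s ∈ A ∪ B
        · left
          rw [← comp_insert_fst] at hs
          rw [hA, hB, ← comp_insert_fst]
          exact (comp_eq_iff.2 (mem_comp'.1 hs)).symm
        · right
          have hs1 : s ∉ A := fun h => hs (Finset.mem_union_left _ h)
          have hs2 : s ∉ B := fun h => hs (Finset.mem_union_right _ h)
          rw [comp_insert_not hs1 hs2]
          refine ⟨?_, ?_, s, rfl⟩
          · intro h; rw [← h] at hs2; exact hs2 (self_mem_comp _ _ _)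
          · intro h; rw [← h] at hs1; exact hs1 (self_mem_comp _ _ _)
      · rintro (rfl | ⟨h1, h2, s, rfl⟩)
        · exact ⟨_, comp_insert_fst ends S e⟩
        · refine ⟨s, comp_insert_not ?_ ?_⟩
          · intro h; exact h2 (comp_eq_iff.2 (mem_comp'.1 h)).symm
          · intro h; exact h1 (comp_eq_iff.2 (mem_comp'.1 h)).symm
    have hnot : A ∪ B ∉ ((comps ends S).erase A).erase B := by
      intro hm
      rw [Finset.mem_erase, Finset.mem_erase, mem_comps] at hm
      obtain ⟨-, h2, s, hs⟩ := hm
      apply h2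
      have : (ends e).1 ∈ comp ends S s := by
        rw [hs]; exact Finset.mem_union_left _ (self_mem_comp _ _ _)
      rw [← hs]
      exact comp_eq_iff.2 (mem_comp'.1 this)
    rw [hcomp, Finset.prod_insert hnot, ← Finset.mul_prod_erase _ _ hAm,
      ← Finset.mul_prod_erase _ _ hBm, Finset.prod_union hdisj]
    have := mul_nonneg (hnn A) (hnn B)
    field_simp

lemma prod_mem_Icc (lam : V → ℝ) (hlam : ∀ v, lam v ∈ Set.Ico (0 : ℝ) 1) (C : Finset V) :
    0 ≤ ∏ v ∈ C, lam v ∧ ∏ v ∈ C, lam v ≤ 1 :=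
  ⟨Finset.prod_nonneg fun v _ => (hlam v).1,
    Finset.prod_le_one (fun v _ => (hlam v).1) (fun v _ => (hlam v).2.le)⟩

lemma frac_anti {a b a' b' : ℝ} (ha' : 0 ≤ a') (haa : a' ≤ a) (ha : a ≤ 1) (hb' : 0 ≤ b')
    (hbb : b' ≤ b) (hb : b ≤ 1) :
    (1 + a') * (1 + b') / (1 + a' * b') ≤ (1 + a) * (1 + b) / (1 + a * b) ∧
    (1 + a) * (1 + b) / (1 + a * b) - (1 + a') * (1 + b') / (1 + a' * b') ≤
      (a - a') + (b - b') := by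
  have one : ∀ x x' y : ℝ, 0 ≤ x' → x' ≤ x → x ≤ 1 → 0 ≤ y → y ≤ 1 →
      0 ≤ (1 + x) * (1 + y) / (1 + x * y) - (1 + x') * (1 + y) / (1 + x' * y) ∧
      (1 + x) * (1 + y) / (1 + x * y) - (1 + x') * (1 + y) / (1 + x' * y) ≤ x - x' := by
    intro x x' y h1 h2 h3 h4 h5
    have hx : 0 ≤ x := h1.trans h2
    have p1 : 0 ≤ x * y := mul_nonneg hx h4
    have p2 : 0 ≤ x' * y := mul_nonneg h1 h4
    have e : (1 + x) * (1 + y) / (1 + x * y) - (1 + x') * (1 + y) / (1 + x' * y) =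
        (x - x') * ((1 - y ^ 2) / ((1 + x * y) * (1 + x' * y))) := by
      field_simp
      ring
    have q1 : 0 ≤ (1 - y ^ 2) / ((1 + x * y) * (1 + x' * y)) := by
      apply div_nonneg <;> nlinarith
    have q2 : (1 - y ^ 2) / ((1 + x * y) * (1 + x' * y)) ≤ 1 := by
      rw [div_le_one (by positivity)]
      nlinarith [mul_nonneg p1 p2]
    rw [e]
    constructor
    · exact mul_nonneg (by linarith) q1
    · nlinarith
  have h1 := one a a' b ha' haa ha (hb'.trans hbb) hb
  have h2 := one b b' a' hb' hbb hb ha' (haa.trans ha)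
  have e1 : (1 + b) * (1 + a') / (1 + b * a') = (1 + a') * (1 + b) / (1 + a' * b) := by
    rw [mul_comm (1 + b), mul_comm b]
  have e2 : (1 + b') * (1 + a') / (1 + b' * a') = (1 + a') * (1 + b') / (1 + a' * b') := by
    rw [mul_comm (1 + b'), mul_comm b']
  rw [e1, e2] at h2
  constructor <;> linarith [h1.1, h1.2, h2.1, h2.2]

lemma K0_bounds (ends : E → V × V) (lam : V → ℝ) (hlam : ∀ v, lam v ∈ Set.Ico (0 : ℝ) 1)
    (S : Finset E) (e : E) : 1 ≤ K0 ends lam S e ∧ K0 ends lam S e ≤ 2 := by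
  unfold K0
  split_ifs with h
  · norm_num
  · have hA := prod_mem_Icc lam hlam (comp ends S (ends e).1)
    have hB := prod_mem_Icc lam hlam (comp ends S (ends e).2)
    set a := ∏ v ∈ comp ends S (ends e).1, lam v
    set b := ∏ v ∈ comp ends S (ends e).2, lam v
    have := mul_nonneg hA.1 hB.1
    constructor
    · rw [le_div_iff₀ (by linarith)]; nlinarith
    · rw [div_le_iff₀ (by linarith)]; nlinarith

lemma prod_comp_anti (ends : E → V × V) (lam : V → ℝ) (hlam : ∀ v, lam v ∈ Set.Ico (0 : ℝ) 1)
    {S T : Finset E} (hST : S ⊆ T) (x : V) :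
    ∏ v ∈ comp ends T x, lam v ≤ ∏ v ∈ comp ends S x, lam v :=
  Finset.prod_le_prod_of_subset_of_le_one (comp_mono hST x) (fun v _ => (hlam v).1)
    (fun v _ _ => (hlam v).2.le)

lemma K0_anti (ends : E → V × V) (lam : V → ℝ) (hlam : ∀ v, lam v ∈ Set.Ico (0 : ℝ) 1)
    {S T : Finset E} (hST : S ⊆ T) (e : E) : K0 ends lam T e ≤ K0 ends lam S e := by
  by_cases hT : Cn ends T (ends e).1 (ends e).2
  · have : K0 ends lam T e = 1 := by simp [K0, hT]
    rw [this]
    exact (K0_bounds ends lam hlam S e).1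
  · have hS : ¬ Cn ends S (ends e).1 (ends e).2 := fun h => hT (h.mono' hST)
    simp only [K0, hT, hS, if_false]
    exact (frac_anti (prod_mem_Icc lam hlam _).1 (prod_comp_anti ends lam hlam hST _)
      (prod_mem_Icc lam hlam _).2 (prod_mem_Icc lam hlam _).1
      (prod_comp_anti ends lam hlam hST _) (prod_mem_Icc lam hlam _).2).1

/-- the influence term -/
noncomputable def infl (ends : E → V × V) (L : ℝ) (S : Finset E) (e : E) (z : V) : ℝ :=
  if e ∈ cutE ends (comp ends S z) then L ^ (comp ends S z).card else 0

lemma infl_nonneg (ends : E → V × V) {L : ℝ} (hL : 0 ≤ L) (S : Finset E) (e : E) (z : V) :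
    0 ≤ infl ends L S e z := by
  unfold infl
  split_ifs <;> positivity

lemma infl_ge {ends : E → V × V} {L : ℝ} (hL : 0 ≤ L) {S : Finset E} {e : E}
    (h : ¬ Cn ends S (ends e).1 (ends e).2) (z : V) :
    (if z ∈ comp ends S (ends e).1 then L ^ (comp ends S (ends e).1).card else 0) +
    (if z ∈ comp ends S (ends e).2 then L ^ (comp ends S (ends e).2).card else 0) ≤
      infl ends L S e z := by
  have hn := infl_nonneg ends hL S e z
  by_cases h1 : z ∈ comp ends S (ends e).1
  · have h2 : z ∉ comp ends S (ends e).2 := fun h2 =>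
      h ((mem_comp'.1 h1).trans (mem_comp'.1 h2).symm')
    have h3 := comp_eq_iff.2 (mem_comp'.1 h1)
    have : e ∈ cutE ends (comp ends S z) := by
      rw [← h3, mem_cutE]
      have a1 := self_mem_comp ends S (ends e).1
      have a2 : (ends e).2 ∉ comp ends S (ends e).1 := fun hh => h (mem_comp'.1 hh)
      tauto
    simp only [infl, this, if_true, h1, h2, if_false]
    rw [h3]; simp
  · by_cases h2 : z ∈ comp ends S (ends e).2
    · have h3 := comp_eq_iff.2 (mem_comp'.1 h2)
      have : e ∈ cutE ends (comp ends S z) := by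
        rw [← h3, mem_cutE]
        have a1 := self_mem_comp ends S (ends e).2
        have a2 : (ends e).1 ∉ comp ends S (ends e).2 := fun hh => h (mem_comp'.1 hh).symm'
        tauto
      simp only [infl, this, if_true, h1, h2, if_false]
      rw [h3]; simp
    · simp only [h1, h2, if_false]; linarith

lemma K0_lip (ends : E → V × V) (lam : V → ℝ) (hlam : ∀ v, lam v ∈ Set.Ico (0 : ℝ) 1)
    {L : ℝ} (hL : ∀ v, lam v ≤ L) (hL0 : 0 ≤ L) (S : Finset E) (e f : E) :
    K0 ends lam S e - K0 ends lam (insert f S) e ≤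
      infl ends L S e (ends f).1 + infl ends L S e (ends f).2 := by
  have hx := infl_nonneg ends hL0 S e (ends f).1
  have hy := infl_nonneg ends hL0 S e (ends f).2
  by_cases hS : Cn ends S (ends e).1 (ends e).2
  · have hT : Cn ends (insert f S) (ends e).1 (ends e).2 := hS.mono' (Finset.subset_insert f S)
    simp only [K0, hS, hT, if_true]
    linarith
  · have gx := infl_ge hL0 hS (ends f).1
    have gy := infl_ge hL0 hS (ends f).2
    have hA := prod_mem_Icc lam hlam (comp ends S (ends e).1)
    have hB := prod_mem_Icc lam hlam (comp ends S (ends e).2)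
    have lA : ∏ v ∈ comp ends S (ends e).1, lam v ≤ L ^ (comp ends S (ends e).1).card := by
      rw [← Finset.prod_const]
      exact Finset.prod_le_prod (fun v _ => (hlam v).1) (fun v _ => hL v)
    have lB : ∏ v ∈ comp ends S (ends e).2, lam v ≤ L ^ (comp ends S (ends e).2).card := by
      rw [← Finset.prod_const]
      exact Finset.prod_le_prod (fun v _ => (hlam v).1) (fun v _ => hL v)
    have pA : 0 ≤ L ^ (comp ends S (ends e).1).card := by positivity
    have pB : 0 ≤ L ^ (comp ends S (ends e).2).card := by positivity
    by_cases hT : Cn ends (insert f S) (ends e).1 (ends e).2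
    · have hle : K0 ends lam S e - K0 ends lam (insert f S) e ≤
          L ^ (comp ends S (ends e).1).card + L ^ (comp ends S (ends e).2).card := by
        simp only [K0, hS, hT, if_true, if_false]
        have := mul_nonneg hA.1 hB.1
        rw [sub_le_iff_le_add, div_le_iff₀ (by linarith)]
        nlinarith
      rcases Cn_insert.1 hT with h | ⟨h1, h2⟩ | ⟨h1, h2⟩
      · exact absurd h hS
      · rw [if_pos (mem_comp'.2 h1)] at gx
        rw [if_pos (mem_comp'.2 h2.symm')] at gy
        have : ∀ (P : Prop) [Decidable P] (t : ℝ), 0 ≤ t → 0 ≤ if P then t else 0 := by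
          intro P _ t ht; split_ifs <;> linarith
        linarith [this ((ends f).1 ∈ comp ends S (ends e).2) _ pB,
          this ((ends f).2 ∈ comp ends S (ends e).1) _ pA]
      · rw [if_pos (mem_comp'.2 h1)] at gy
        rw [if_pos (mem_comp'.2 h2.symm')] at gx
        have : ∀ (P : Prop) [Decidable P] (t : ℝ), 0 ≤ t → 0 ≤ if P then t else 0 := by
          intro P _ t ht; split_ifs <;> linarith
        linarith [this ((ends f).2 ∈ comp ends S (ends e).2) _ pB,
          this ((ends f).1 ∈ comp ends S (ends e).1) _ pA]
    · have hsub := Finset.subset_insert f S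
      have aA := prod_comp_anti ends lam hlam hsub (ends e).1
      have aB := prod_comp_anti ends lam hlam hsub (ends e).2
      have cA := prod_mem_Icc lam hlam (comp ends (insert f S) (ends e).1)
      have cB := prod_mem_Icc lam hlam (comp ends (insert f S) (ends e).2)
      have hle := (frac_anti cA.1 aA hA.2 cB.1 aB hB.2).2
      have hle' : K0 ends lam S e - K0 ends lam (insert f S) e ≤
          (∏ v ∈ comp ends S (ends e).1, lam v -
            ∏ v ∈ comp ends (insert f S) (ends e).1, lam v) +
          (∏ v ∈ comp ends S (ends e).2, lam v -
            ∏ v ∈ comp ends (insert f S) (ends e).2, lam v) := by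
        simp only [K0, hS, hT, if_false]
        exact hle
      have part : ∀ s : V, 0 ≤ ∏ v ∈ comp ends (insert f S) s, lam v →
          ∏ v ∈ comp ends S s, lam v ≤ L ^ (comp ends S s).card →
          0 ≤ L ^ (comp ends S s).card →
          ∏ v ∈ comp ends S s, lam v - ∏ v ∈ comp ends (insert f S) s, lam v ≤
          (if (ends f).1 ∈ comp ends S s then L ^ (comp ends S s).card else 0) +
          (if (ends f).2 ∈ comp ends S s then L ^ (comp ends S s).card else 0) := by
        intro s h1 h2 h3
        by_cases m1 : (ends f).1 ∈ comp ends S s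
        · rw [if_pos m1]
          split_ifs <;> linarith
        · by_cases m2 : (ends f).2 ∈ comp ends S s
          · rw [if_pos m2, if_neg m1]; linarith
          · rw [if_neg m1, if_neg m2]
            rw [mem_comp'] at m1 m2
            rw [comp_insert_not]
            · simp
            · rw [mem_comp']; exact fun h => m1 h.symm'
            · rw [mem_comp']; exact fun h => m2 h.symm'
      linarith [part _ cA.1 lA pA, part _ cB.1 lB pB]

lemma rcWeight_pos (ends : E → V × V) (p : E → ℝ) (lam : V → ℝ)
    (hp : ∀ e, p e ∈ Set.Ioo (0 : ℝ) 1) (hlam : ∀ v, lam v ∈ Set.Ico (0 : ℝ) 1) (S : Finset E) :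
    0 < rcWeight ends p lam univ S := by
  unfold rcWeight
  refine mul_pos (mul_pos (Finset.prod_pos fun e _ => (hp e).1)
    (Finset.prod_pos fun e _ => by linarith [(hp e).2])) (Finset.prod_pos fun C _ => ?_)
  linarith [(prod_mem_Icc lam hlam C).1]

lemma rcProb_eq (ends : E → V × V) (p : E → ℝ) (lam : V → ℝ) (S : Finset E) :
    rcProb ends p lam univ S = rcWeight ends p lam univ S / ∑ T, rcWeight ends p lam univ T := by
  simp [rcProb]

lemma rcProb_pos (ends : E → V × V) (p : E → ℝ) (lam : V → ℝ)
    (hp : ∀ e, p e ∈ Set.Ioo (0 : ℝ) 1) (hlam : ∀ v, lam v ∈ Set.Ico (0 : ℝ) 1) (S : Finset E) :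
    0 < rcProb ends p lam univ S := by
  rw [rcProb_eq]
  exact div_pos (rcWeight_pos ends p lam hp hlam S)
    (Finset.sum_pos (fun T _ => rcWeight_pos ends p lam hp hlam T) Finset.univ_nonempty)

lemma rcProb_sum (ends : E → V × V) (p : E → ℝ) (lam : V → ℝ)
    (hp : ∀ e, p e ∈ Set.Ioo (0 : ℝ) 1) (hlam : ∀ v, lam v ∈ Set.Ico (0 : ℝ) 1) :
    ∑ S, rcProb ends p lam univ S = 1 := by
  simp_rw [rcProb_eq]
  rw [← Finset.sum_div]
  exact div_self (Finset.sum_pos (fun T _ => rcWeight_pos ends p lam hp hlam T)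
    Finset.univ_nonempty).ne'

lemma marg_eq (ends : E → V × V) (p : E → ℝ) (lam : V → ℝ)
    (hp : ∀ e, p e ∈ Set.Ioo (0 : ℝ) 1) (hlam : ∀ v, lam v ∈ Set.Ico (0 : ℝ) 1)
    (X : Finset E) (e : E) :
    marg (rcProb ends p lam univ) X e =
      p e / (p e + (1 - p e) * K0 ends lam (X.erase e) e) := by
  have hZ : 0 < ∑ T, rcWeight ends p lam univ T :=
    Finset.sum_pos (fun T _ => rcWeight_pos ends p lam hp hlam T) Finset.univ_nonempty
  have hins : insert e X = insert e (X.erase e) := by grind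
  have hne : e ∉ X.erase e := by simp
  have hK := (K0_bounds ends lam hlam (X.erase e) e).1
  unfold marg
  rw [rcProb_eq, rcProb_eq, hins]
  generalize X.erase e = Y at *
  have hW := compsW_insert ends lam hlam Y e
  have hu : univ \ Y = insert e (univ \ insert e Y) := by
    ext g
    by_cases hg : g = e
    · subst hg; simp [hne]
    · simp [hg]
  unfold rcWeight at *
  rw [hW, hu, Finset.prod_insert hne, Finset.prod_insert (by simp)]
  have a1 : 0 < ∏ e ∈ Y, p e := Finset.prod_pos fun e _ => (hp e).1
  have a2 : 0 < ∏ e ∈ univ \ insert e Y, (1 - p e) :=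
    Finset.prod_pos fun e _ => by linarith [(hp e).2]
  have a3 : 0 < ∏ C ∈ comps ends (insert e Y), (1 + ∏ v ∈ C, lam v) :=
    Finset.prod_pos fun C _ => by linarith [(prod_mem_Icc lam hlam C).1]
  set c1 := ∏ e ∈ Y, p e
  set c2 := ∏ e ∈ univ \ insert e Y, (1 - p e)
  set c3 := ∏ C ∈ comps ends (insert e Y), (1 + ∏ v ∈ C, lam v)
  set Z := ∑ T, (∏ e ∈ T, p e) * (∏ e ∈ univ \ T, (1 - p e)) *
    ∏ C ∈ comps ends T, (1 + ∏ v ∈ C, lam v)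
  have b1 := (hp e).1
  have b2 := (hp e).2
  have : 0 < p e + (1 - p e) * K0 ends lam Y e := by nlinarith
  rw [← add_div, div_div_div_cancel_right₀ hZ.ne', div_eq_div_iff]
  · ring
  · have : p e * c1 * c2 * c3 + c1 * ((1 - p e) * c2) * (K0 ends lam Y e * c3) =
      (c1 * c2 * c3) * (p e + (1 - p e) * K0 ends lam Y e) := by ring
    rw [this]
    positivity
  · exact this.ne'


/-! ### The Glauber operator -/

/-- one step of the Glauber dynamics acting on functions -/
noncomputable def pOp (μ : Finset E → ℝ) : Module.End ℝ (Finset E → ℝ) where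
  toFun f := fun X => (Fintype.card E : ℝ)⁻¹ *
    ∑ e, (marg μ X e * f (insert e X) + (1 - marg μ X e) * f (X.erase e))
  map_add' f g := by
    funext X
    simp only [Pi.add_apply, mul_add, Finset.sum_add_distrib]
    ring
  map_smul' c f := by
    funext X
    simp only [Pi.smul_apply, smul_eq_mul, RingHom.id_apply]
    rw [Finset.mul_sum, Finset.mul_sum, Finset.mul_sum]
    refine Finset.sum_congr rfl fun e _ => ?_
    ring

lemma pOp_apply (μ f : Finset E → ℝ) (X : Finset E) :
    pOp μ f X = (Fintype.card E : ℝ)⁻¹ *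
    ∑ e, (marg μ X e * f (insert e X) + (1 - marg μ X e) * f (X.erase e)) := rfl

lemma pOp_couple {μ : Finset E → ℝ} (h01 : ∀ X e, 0 ≤ marg μ X e ∧ marg μ X e ≤ 1)
    (hmono : ∀ Y Z e, Y ⊆ Z → marg μ Y e ≤ marg μ Z e) {f g : Finset E → ℝ}
    (hfg : ∀ Y Z, Y ⊆ Z → f Z ≤ g Y) : ∀ Y Z, Y ⊆ Z → pOp μ f Z ≤ pOp μ g Y := by
  intro Y Z hYZ
  rw [pOp_apply, pOp_apply]
  apply mul_le_mul_of_nonneg_left _ (by positivity)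
  apply Finset.sum_le_sum
  intro e _
  have h1 := hfg _ _ (Finset.insert_subset_insert e hYZ)
  have h2 := hfg (Y.erase e) (insert e Z) ((Finset.erase_subset _ _).trans
    (hYZ.trans (Finset.subset_insert _ _)))
  have h3 := hfg _ _ (Finset.erase_subset_erase e hYZ)
  have h4 := hmono Y Z e hYZ
  have h5 := h01 Y e
  have h6 := h01 Z e
  nlinarith [mul_nonneg h5.1 (sub_nonneg.2 h1), mul_nonneg (sub_nonneg.2 h4) (sub_nonneg.2 h2),
    mul_nonneg (sub_nonneg.2 h6.2) (sub_nonneg.2 h3)]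

lemma sum_split (e : E) (F : Finset E → ℝ) :
    ∑ X, F X = ∑ X ∈ (univ.erase e).powerset, (F X + F (insert e X)) := by
  have h : (univ : Finset (Finset E)) = (insert e (univ.erase e)).powerset := by
    ext; simp
  rw [h, Finset.sum_powerset_insert (by simp), Finset.sum_add_distrib]

lemma marg_insert (μ : Finset E → ℝ) (X : Finset E) (e : E) :
    marg μ (insert e X) e = marg μ X e := by
  unfold marg
  simp

lemma pOp_stat [Nonempty E] {μ : Finset E → ℝ} (hpos : ∀ X, 0 < μ X) (f : Finset E → ℝ) :
    ∑ X, μ X * pOp μ f X = ∑ X, μ X * f X := by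
  have key : ∀ e, ∑ X, μ X * (marg μ X e * f (insert e X) + (1 - marg μ X e) * f (X.erase e)) =
      ∑ X, μ X * f X := by
    intro e
    rw [sum_split e, sum_split e]
    refine Finset.sum_congr rfl fun X hX => ?_
    have he : e ∉ X := fun h => by
      have := Finset.mem_powerset.1 hX h
      simp at this
    rw [marg_insert, Finset.insert_idem, Finset.erase_insert he, Finset.erase_eq_of_notMem he]
    have h1 := hpos X
    have h2 := hpos (insert e X)
    have : marg μ X e = μ (insert e X) / (μ (insert e X) + μ X) := by
      unfold marg
      rw [Finset.erase_eq_of_notMem he]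
    rw [this]
    field_simp
    ring
  simp_rw [pOp_apply, mul_left_comm (μ _), ← Finset.mul_sum, Finset.mul_sum (Finset.univ : Finset E)]
  rw [Finset.sum_comm]
  simp_rw [key]
  rw [Finset.sum_const, Finset.card_univ, nsmul_eq_mul, ← mul_assoc, inv_mul_cancel₀, one_mul]
  exact_mod_cast Fintype.card_ne_zero

lemma pOp_pow_stat [Nonempty E] {μ : Finset E → ℝ} (hpos : ∀ X, 0 < μ X) (f : Finset E → ℝ)
    (t : ℕ) : ∑ X, μ X * (pOp μ ^ t) f X = ∑ X, μ X * f X := by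
  induction t with
  | zero => simp
  | succ t ih =>
    rw [pow_succ', Module.End.mul_apply, pOp_stat hpos, ih]

/-- the cardinality function -/
def cardF : Finset E → ℝ := fun X => (X.card : ℝ)

lemma pOp_cardF [Nonempty E] (μ : Finset E → ℝ) (X : Finset E) :
    pOp μ cardF X = (1 - (Fintype.card E : ℝ)⁻¹) * X.card +
      (Fintype.card E : ℝ)⁻¹ * ∑ e, marg μ X e := by
  have hc : (Fintype.card E : ℝ) ≠ 0 := by exact_mod_cast Fintype.card_ne_zero
  have key : ∀ e, marg μ X e * cardF (insert e X) + (1 - marg μ X e) * cardF (X.erase e) =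
      (X.card : ℝ) + marg μ X e - if e ∈ X then 1 else 0 := by
    intro e
    unfold cardF
    by_cases he : e ∈ X
    · rw [Finset.insert_eq_of_mem he, if_pos he]
      have : ((X.erase e).card : ℝ) = X.card - 1 := by
        rw [eq_sub_iff_add_eq]
        exact_mod_cast Finset.card_erase_add_one he
      rw [this]; ring
    · rw [Finset.erase_eq_of_notMem he, if_neg he, Finset.card_insert_of_notMem he]
      push_cast; ring
  rw [pOp_apply]
  simp_rw [key]
  rw [Finset.sum_sub_distrib, Finset.sum_add_distrib, Finset.sum_const, Finset.card_univ,
    nsmul_eq_mul]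
  simp only [Finset.sum_ite_mem, Finset.univ_inter, Finset.sum_const, nsmul_eq_mul, mul_one]
  field_simp
  ring

lemma contraction [Nonempty E] {μ : Finset E → ℝ} (hpos : ∀ X, 0 < μ X)
    (h01 : ∀ X e, 0 ≤ marg μ X e ∧ marg μ X e ≤ 1)
    (hmono : ∀ Y Z e, Y ⊆ Z → marg μ Y e ≤ marg μ Z e) (β : Finset E → ℝ)
    (hβ : ∀ Y Z, Y ⊆ Z → ∑ e, marg μ Z e - ∑ e, marg μ Y e ≤
      (1 / 2) * ((Z.card : ℝ) - Y.card) + β Y) (t : ℕ) :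
    ∃ B : Finset E → ℝ,
      (∀ Y Z, Y ⊆ Z → (pOp μ ^ t) cardF Z - (pOp μ ^ t) cardF Y ≤
        (1 - 1 / (2 * (Fintype.card E : ℝ))) ^ t * ((Z.card : ℝ) - Y.card) + B Y) ∧
      ∑ Y, μ Y * B Y = 2 * (1 - (1 - 1 / (2 * (Fintype.card E : ℝ))) ^ t) * ∑ Y, μ Y * β Y := by
  have hc : 1 ≤ (Fintype.card E : ℝ) := by exact_mod_cast Fintype.card_pos
  set m : ℝ := (Fintype.card E : ℝ) with hm
  set ρ : ℝ := 1 - 1 / (2 * m) with hρ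
  have hρ0 : 0 ≤ ρ := by
    rw [hρ, sub_nonneg, div_le_one (by linarith)]; linarith
  induction t with
  | zero =>
    refine ⟨0, ?_, by simp⟩
    intro Y Z _
    simp [cardF]
  | succ t ih =>
    obtain ⟨B, hB1, hB2⟩ := ih
    refine ⟨pOp μ B + (ρ ^ t * m⁻¹) • β, ?_, ?_⟩
    · intro Y Z hYZ
      have h := pOp_couple h01 hmono (f := (pOp μ ^ t) cardF - ρ ^ t • cardF)
        (g := (pOp μ ^ t) cardF - ρ ^ t • cardF + B) (by
          intro Y Z hYZ
          have := hB1 Y Z hYZ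
          simp only [Pi.sub_apply, Pi.add_apply, Pi.smul_apply, smul_eq_mul, cardF]
          linarith) Y Z hYZ
      rw [map_add, map_sub, map_smul] at h
      simp only [Pi.sub_apply, Pi.add_apply, Pi.smul_apply, smul_eq_mul, pOp_cardF] at h ⊢
      rw [pow_succ' (pOp μ), Module.End.mul_apply]
      have h2 := hβ Y Z hYZ
      have h3 : (1 - m⁻¹) * (Z.card : ℝ) + m⁻¹ * ∑ e, marg μ Z e -
          ((1 - m⁻¹) * (Y.card : ℝ) + m⁻¹ * ∑ e, marg μ Y e) ≤
          ρ * ((Z.card : ℝ) - Y.card) + m⁻¹ * β Y := by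
        have h4 := mul_le_mul_of_nonneg_left h2 (show 0 ≤ m⁻¹ by positivity)
        have h5 : ρ = 1 - m⁻¹ / 2 := by rw [hρ]; field_simp
        rw [h5]
        linarith
      have h6 := mul_le_mul_of_nonneg_left h3 (show 0 ≤ ρ ^ t by positivity)
      rw [pow_succ]
      linarith
    · simp only [Pi.add_apply, Pi.smul_apply, smul_eq_mul, mul_add, Finset.sum_add_distrib]
      rw [pOp_stat hpos, hB2]
      simp_rw [mul_left_comm (μ _)]
      rw [← Finset.mul_sum, pow_succ]
      have : m⁻¹ = 2 * (1 - ρ) := by rw [hρ]; field_simp; ring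
      rw [this]; ring

lemma tv_bound [Nonempty E] {μ : Finset E → ℝ} (hpos : ∀ X, 0 < μ X) (hsum : ∑ X, μ X = 1)
    (h01 : ∀ X e, 0 ≤ marg μ X e ∧ marg μ X e ≤ 1)
    (hmono : ∀ Y Z e, Y ⊆ Z → marg μ Y e ≤ marg μ Z e) (β : Finset E → ℝ) (hβ0 : ∀ Y, 0 ≤ β Y)
    (hβ : ∀ Y Z, Y ⊆ Z → ∑ e, marg μ Z e - ∑ e, marg μ Y e ≤
      (1 / 2) * ((Z.card : ℝ) - Y.card) + β Y)
    (pr : Finset E → ℝ) (hpr0 : ∀ X, 0 ≤ pr X) (hpr : ∑ X, pr X = 1)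
    (hdom : ∀ f : Finset E → ℝ, Monotone f → ∑ X, μ X * f X ≤ ∑ X, pr X * f X) (t : ℕ) :
    (1 / 2) * ∑ a, |∑ X, pr X * (pOp μ ^ t) (Pi.single a 1) X - μ a| ≤
      (1 - 1 / (2 * (Fintype.card E : ℝ))) ^ t * Fintype.card E + 2 * ∑ Y, μ Y * β Y := by
  have hc : 1 ≤ (Fintype.card E : ℝ) := by exact_mod_cast Fintype.card_pos
  set g : Finset E → ℝ := fun a =>
    if 0 ≤ ∑ X, pr X * (pOp μ ^ t) (Pi.single a 1) X - μ a then 1 else -1 with hg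
  have hg1 : ∀ a, -1 ≤ g a ∧ g a ≤ 1 := by
    intro a; simp only [hg]; split_ifs <;> norm_num
  have hgsum : g = ∑ a, g a • (Pi.single a 1 : Finset E → ℝ) := by
    funext b
    simp [Finset.sum_apply, Pi.single_apply]
  have hPg : ∀ X, (pOp μ ^ t) g X = ∑ a, g a * (pOp μ ^ t) (Pi.single a 1) X := by
    intro X
    conv_lhs => rw [hgsum, map_sum]
    rw [Finset.sum_apply]
    refine Finset.sum_congr rfl fun a _ => ?_
    rw [map_smul]; rfl
  have e1 : ∑ a, |∑ X, pr X * (pOp μ ^ t) (Pi.single a 1) X - μ a| =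
      ∑ X, pr X * (pOp μ ^ t) g X - ∑ X, μ X * (pOp μ ^ t) g X := by
    have : ∀ a, |∑ X, pr X * (pOp μ ^ t) (Pi.single a 1) X - μ a| =
        g a * (∑ X, pr X * (pOp μ ^ t) (Pi.single a 1) X) - μ a * g a := by
      intro a
      simp only [hg]
      split_ifs with h
      · rw [abs_of_nonneg h]; ring
      · rw [abs_of_neg (not_le.1 h)]; ring
    rw [Finset.sum_congr rfl fun a _ => this a, Finset.sum_sub_distrib, pOp_pow_stat hpos]
    congr 1
    simp_rw [hPg, Finset.mul_sum]
    rw [Finset.sum_comm]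
    refine Finset.sum_congr rfl fun a _ => Finset.sum_congr rfl fun b _ => by ring
  have hpowmono : ∀ (t : ℕ) (f : Finset E → ℝ), Monotone f → Monotone ((pOp μ ^ t) f) := by
    intro t
    induction t with
    | zero => intro f hf; simpa using hf
    | succ t ih =>
      intro f hf
      rw [pow_succ, Module.End.mul_apply]
      apply ih
      intro Y Z hYZ
      have := pOp_couple h01 hmono (f := -f) (g := -f) (by
        intro Y Z h
        simpa using hf h) Y Z hYZ
      rw [map_neg] at this
      simpa using this
  have hm1 : Monotone ((2 : ℝ) • cardF - g) := by
    intro Y Z hYZ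
    simp only [Pi.sub_apply, Pi.smul_apply, smul_eq_mul, cardF]
    rcases eq_or_ne Y Z with rfl | hne
    · exact le_rfl
    · have : Y.card + 1 ≤ Z.card := Finset.card_lt_card (lt_of_le_of_ne hYZ hne)
      have : (Y.card : ℝ) + 1 ≤ Z.card := by exact_mod_cast this
      linarith [(hg1 Y).1, (hg1 Z).2]
  have hd := hdom _ (hpowmono t _ hm1)
  rw [map_sub, map_smul] at hd
  simp only [Pi.sub_apply, Pi.smul_apply, smul_eq_mul, mul_sub, Finset.sum_sub_distrib] at hd
  obtain ⟨B, hB1, hB2⟩ := contraction hpos h01 hmono β hβ t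
  have hmN : Monotone ((pOp μ ^ t) cardF) := hpowmono t _ (by
    intro Y Z h
    simp only [cardF]
    exact_mod_cast Finset.card_le_card h)
  have e2 : ∑ X, pr X * (pOp μ ^ t) cardF X ≤ (pOp μ ^ t) cardF univ := by
    calc _ ≤ ∑ X, pr X * (pOp μ ^ t) cardF univ :=
          Finset.sum_le_sum fun X _ => mul_le_mul_of_nonneg_left (hmN (Finset.subset_univ X)) (hpr0 X)
      _ = _ := by rw [← Finset.sum_mul, hpr, one_mul]
  have hρ0 : 0 ≤ 1 - 1 / (2 * (Fintype.card E : ℝ)) := by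
    rw [sub_nonneg, div_le_one (by linarith)]; linarith
  set ρ : ℝ := 1 - 1 / (2 * (Fintype.card E : ℝ))
  have e3 : (pOp μ ^ t) cardF univ - ∑ X, μ X * (pOp μ ^ t) cardF X ≤
      ρ ^ t * Fintype.card E + ∑ Y, μ Y * B Y := by
    calc _ = ∑ Y, μ Y * ((pOp μ ^ t) cardF univ - (pOp μ ^ t) cardF Y) := by
          simp only [mul_sub, Finset.sum_sub_distrib]
          rw [← Finset.sum_mul, hsum, one_mul]
      _ ≤ ∑ Y, μ Y * (ρ ^ t * Fintype.card E + B Y) := by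
          refine Finset.sum_le_sum fun Y _ => mul_le_mul_of_nonneg_left ?_ (hpos Y).le
          have := hB1 Y univ (Finset.subset_univ Y)
          rw [Finset.card_univ] at this
          have h2 : 0 ≤ ρ ^ t * (Y.card : ℝ) := by positivity
          linarith
      _ = _ := by
          simp only [mul_add, Finset.sum_add_distrib]
          rw [← Finset.sum_mul, hsum, one_mul]
  have hb : 0 ≤ ∑ Y, μ Y * β Y := Finset.sum_nonneg fun Y _ => mul_nonneg (hpos Y).le (hβ0 Y)
  have hpt : 0 ≤ ρ ^ t := by positivity
  rw [e1]
  simp_rw [mul_left_comm _ (2 : ℝ), ← Finset.mul_sum] at hd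
  rw [hB2] at e3
  nlinarith


/-! ### The law of the simulated chain -/

/-- the uniform measure on `[0,1]` -/
noncomputable abbrev uni : Measure ℝ := volume.restrict (Set.Icc (0 : ℝ) 1)

instance uni_prob : IsProbabilityMeasure (volume.restrict (Set.Icc (0 : ℝ) 1)) :=
  ⟨by simp⟩

lemma uni_int {c : ℝ} (h0 : 0 ≤ c) (h1 : c ≤ 1) (a b : ℝ) :
    ∫ t, (if t < c then a else b) ∂uni = c * a + (1 - c) * b := by
  have e : (fun t : ℝ => if t < c then a else b) =
      fun t => b + (Set.Iio c).indicator (fun _ => a - b) t := by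
    funext t
    by_cases h : t < c <;> simp [Set.indicator, h]
  have hm : (uni.real (Set.Iio c)) = c := by
    have : Set.Iio c ∩ Set.Icc 0 1 = Set.Ico 0 c := by
      ext t; simp only [Set.mem_inter_iff, Set.mem_Iio, Set.mem_Icc, Set.mem_Ico]
      constructor
      · rintro ⟨a, b, _⟩; exact ⟨b, a⟩
      · rintro ⟨a, b⟩; exact ⟨b, a, by linarith⟩
    rw [Measure.real, uni, Measure.restrict_apply measurableSet_Iio, this]
    simp [h0]
  rw [e, integral_add (integrable_const _) ((integrable_const _).indicator measurableSet_Iio),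
    integral_indicator_const _ measurableSet_Iio, hm]
  simp
  ring

lemma glauber_init {T : ℕ} (μ : Finset E → ℝ) (es : Fin (T + 1) → E) (r : Fin (T + 1) → ℝ)
    (X0 : Finset E) (i : ℕ) (hi : i ≤ T) :
    glauber μ es r X0 i =
      glauber μ (fun j => es j.castSucc) (fun j => r j.castSucc) X0 i := by
  induction i with
  | zero => rfl
  | succ i ih =>
    have h1 : i < T + 1 := by omega
    have h2 : i < T := by omega
    simp only [glauber, h1, h2, dif_pos, ih (by omega)]
    rfl

/-- one update -/
noncomputable def gstep (μ : Finset E → ℝ) (e : E) (t : ℝ) (A : Finset E) : Finset E :=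
  if t < marg μ A e then insert e A else A.erase e

lemma glauber_last {T : ℕ} (μ : Finset E → ℝ) (es : Fin (T + 1) → E) (r : Fin (T + 1) → ℝ)
    (X0 : Finset E) :
    glauber μ es r X0 (T + 1) = gstep μ (es (Fin.last T)) (r (Fin.last T))
      (glauber μ (fun j => es j.castSucc) (fun j => r j.castSucc) X0 T) := by
  rw [← glauber_init μ es r X0 T le_rfl]
  simp only [glauber, Nat.lt_succ_self, dif_pos, gstep]
  rfl

lemma glauber_meas {T : ℕ} (μ : Finset E → ℝ) (es : Fin T → E) (X0 : Finset E) (i : ℕ) :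
    Measurable[_, ⊤] (fun r : Fin T → ℝ => glauber μ es r X0 i) := by
  letI : MeasurableSpace (Finset E) := ⊤
  induction i with
  | zero => exact measurable_const
  | succ i ih =>
    by_cases h : i < T
    · have : (fun r : Fin T → ℝ => glauber μ es r X0 (i + 1)) =
          (fun q : ℝ × Finset E => gstep μ (es ⟨i, h⟩) q.1 q.2) ∘
            (fun r => (r ⟨i, h⟩, glauber μ es r X0 i)) := by
        funext r
        simp only [glauber, h, dif_pos, gstep, Function.comp]
      rw [this]
      refine Measurable.comp ?_ ((measurable_pi_apply _).prodMk ih)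
      apply measurable_from_prod_countable_left
      intro A
      show Measurable (fun x : ℝ => if x < marg μ A (es ⟨i, h⟩) then insert (es ⟨i, h⟩) A
        else A.erase (es ⟨i, h⟩))
      exact Measurable.ite (measurableSet_lt measurable_id measurable_const)
        measurable_const measurable_const
    · simp only [glauber, h, dif_neg, not_false_iff]
      exact ih

lemma glauber_int_succ {T : ℕ} {μ : Finset E → ℝ}
    (h01 : ∀ X e, 0 ≤ marg μ X e ∧ marg μ X e ≤ 1) (es : Fin T → E) (e : E)
    (X0 : Finset E) (f : Finset E → ℝ) :
    ∫ r, f (glauber μ (Fin.snoc (α := fun _ => E) es e) r X0 (T + 1))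
        ∂(Measure.pi (fun _ : Fin (T + 1) => uni)) =
      ∫ r, (marg μ (glauber μ es r X0 T) e * f (insert e (glauber μ es r X0 T)) +
        (1 - marg μ (glauber μ es r X0 T) e) * f ((glauber μ es r X0 T).erase e))
        ∂(Measure.pi (fun _ : Fin T => uni)) := by
  letI : MeasurableSpace (Finset E) := ⊤
  set g : ℝ × (Fin T → ℝ) → ℝ := fun q => f (gstep μ e q.1 (glauber μ es q.2 X0 T)) with hg
  have hmp := measurePreserving_piFinSuccAbove (fun _ : Fin (T + 1) => uni) (Fin.last T)
  have e1 : (fun r => f (glauber μ (Fin.snoc (α := fun _ => E) es e) r X0 (T + 1))) =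
      fun r => g (MeasurableEquiv.piFinSuccAbove (fun _ : Fin (T + 1) => ℝ) (Fin.last T) r) := by
    funext r
    rw [glauber_last]
    simp only [hg, Fin.snoc_last, Fin.snoc_castSucc]
    simp [MeasurableEquiv.piFinSuccAbove, Fin.insertNthEquiv, Fin.init_def]
  have hgm : Measurable g := by
    have h1 : Measurable (fun q : ℝ × Finset E => f (gstep μ e q.1 q.2)) := by
      apply measurable_from_prod_countable_left
      intro A
      have : (fun x => f (gstep μ e (x, A).1 (x, A).2)) =
          fun x => if x < marg μ A e then f (insert e A) else f (A.erase e) := by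
        funext x
        simp only [gstep]
        split_ifs <;> rfl
      rw [this]
      exact Measurable.ite (measurableSet_lt measurable_id measurable_const)
        measurable_const measurable_const
    exact h1.comp (measurable_fst.prodMk ((glauber_meas μ es X0 T).comp measurable_snd))
  rw [e1, hmp.integral_comp' g, integral_prod_symm]
  · refine integral_congr_ae (Filter.Eventually.of_forall fun r => ?_)
    simp only [hg]
    rw [← uni_int (h01 _ _).1 (h01 _ _).2]
    congr 1
    funext t
    unfold gstep
    split_ifs <;> rfl
  · refine Integrable.of_bound hgm.aestronglyMeasurable (∑ A, ‖f A‖)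
      (Filter.Eventually.of_forall fun q => ?_)
    exact Finset.single_le_sum (f := fun A => ‖f A‖) (fun A _ => norm_nonneg _)
      (Finset.mem_univ _)

lemma glauber_integrable {T : ℕ} (μ : Finset E → ℝ) (es : Fin T → E) (X0 : Finset E)
    (f : Finset E → ℝ) :
    Integrable (fun r => f (glauber μ es r X0 T)) (Measure.pi (fun _ : Fin T => uni)) := by
  letI : MeasurableSpace (Finset E) := ⊤
  have hm : Measurable (fun r => f (glauber μ es r X0 T)) :=
    (measurable_from_top (f := f)).comp (glauber_meas μ es X0 T)
  refine Integrable.of_bound hm.aestronglyMeasurable (∑ A, ‖f A‖)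
      (Filter.Eventually.of_forall fun q => ?_)
  exact Finset.single_le_sum (f := fun A => ‖f A‖) (fun A _ => norm_nonneg _)
      (Finset.mem_univ _)

lemma glauber_law {μ : Finset E → ℝ}
    (h01 : ∀ X e, 0 ≤ marg μ X e ∧ marg μ X e ≤ 1) (X0 : Finset E) (T : ℕ) :
    ∀ f : Finset E → ℝ, ∑ es : Fin T → E, (Fintype.card E : ℝ)⁻¹ ^ T *
      ∫ r, f (glauber μ es r X0 T) ∂(Measure.pi (fun _ : Fin T => uni)) =
      (pOp μ ^ T) f X0 := by
  induction T with
  | zero => intro f; simp [glauber]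
  | succ T ih =>
    intro f
    rw [pow_succ (pOp μ), Module.End.mul_apply, ← ih]
    rw [← (Fin.snocEquiv (fun _ => E)).sum_comp, Fintype.sum_prod_type, Finset.sum_comm]
    refine Finset.sum_congr rfl fun es _ => ?_
    simp only [Fin.snocEquiv, Equiv.coe_fn_mk]
    simp_rw [glauber_int_succ h01, pOp_apply]
    rw [integral_const_mul, integral_finset_sum, pow_succ, ← Finset.mul_sum, mul_assoc]
    intro e _
    exact glauber_integrable μ es X0
      (fun A => marg μ A e * f (insert e A) + (1 - marg μ A e) * f (A.erase e))

lemma sim_law [Nonempty E] [MeasurableSpace E] [MeasurableSingletonClass E] {μ : Finset E → ℝ}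
    (h01 : ∀ X e, 0 ≤ marg μ X e ∧ marg μ X e ≤ 1) (T : ℕ) (a : Finset E) :
    ((simMeasure μ T) ((fun ω : (Fin T → E) × (Fin T → ℝ) × (E → Bool) =>
          glauber μ ω.1 ω.2.1 (toSet ω.2.2) T) ⁻¹' {a})).toReal =
      ∑ X, (∏ f, if f ∈ X then marg μ univ f else 1 - marg μ univ f) *
        (pOp μ ^ T) (Pi.single a 1) X := by
  letI : MeasurableSpace (Finset E) := ⊤
  set s := ((fun ω : (Fin T → E) × (Fin T → ℝ) × (E → Bool) =>
          glauber μ ω.1 ω.2.1 (toSet ω.2.2) T) ⁻¹' {a}) with hs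
  have hmeas : MeasurableSet s := by
    have : Measurable (fun ω : (Fin T → E) × (Fin T → ℝ) × (E → Bool) =>
          glauber μ ω.1 ω.2.1 (toSet ω.2.2) T) := by
      apply measurable_from_prod_countable_right
      intro es
      apply measurable_from_prod_countable_left
      intro g
      exact glauber_meas μ es (toSet g) T
    exact this (measurableSet_singleton a)
  have hpr : ∀ g : E → Bool,
      0 ≤ ∏ f : E, if g f then marg μ Finset.univ f else 1 - marg μ Finset.univ f := by
    intro g
    refine Finset.prod_nonneg fun f _ => ?_
    have := h01 univ f
    split_ifs <;> linarith
  have hmap : ∀ (es : Fin T → E) (g : E → Bool),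
      ((Measure.pi (fun _ : Fin T => volume.restrict (Set.Icc (0 : ℝ) 1))).map
        (fun r => (es, r, g))) s =
      ENNReal.ofReal (∫ r, (Pi.single a 1 : Finset E → ℝ) (glauber μ es r (toSet g) T)
        ∂(Measure.pi (fun _ : Fin T => uni))) := by
    intro es g
    rw [Measure.map_apply (by fun_prop) hmeas]
    have hms : MeasurableSet ((fun r : Fin T → ℝ => glauber μ es r (toSet g) T) ⁻¹' {a}) :=
      glauber_meas μ es (toSet g) T (measurableSet_singleton a)
    have : (fun r => (Pi.single a 1 : Finset E → ℝ) (glauber μ es r (toSet g) T)) =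
        ((fun r : Fin T → ℝ => glauber μ es r (toSet g) T) ⁻¹' {a}).indicator (fun _ => 1) := by
      funext r
      simp [Set.indicator, Pi.single_apply]
    rw [this, integral_indicator_const _ hms]
    simp only [smul_eq_mul, mul_one]
    rw [ofReal_measureReal]
    rfl
  rw [simMeasure]
  simp only [Measure.coe_finset_sum, Finset.sum_apply, Measure.smul_apply, hmap, smul_eq_mul]
  have hIntNn : ∀ (es : Fin T → E) (g : E → Bool),
      0 ≤ ∫ r, (Pi.single a 1 : Finset E → ℝ) (glauber μ es r (toSet g) T)
        ∂(Measure.pi (fun _ : Fin T => uni)) := by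
    intro es g
    refine integral_nonneg fun r => ?_
    simp only [Pi.single_apply, Pi.zero_apply]
    split_ifs <;> norm_num
  have hc : (Fintype.card E : ENNReal)⁻¹ ≠ ⊤ := by
    simp
  rw [ENNReal.toReal_sum (by
    intro es _
    refine (ENNReal.sum_lt_top.2 fun g _ => ?_).ne
    exact ENNReal.mul_lt_top (ENNReal.mul_lt_top (ENNReal.pow_lt_top (lt_top_iff_ne_top.2 hc))
      ENNReal.ofReal_lt_top) ENNReal.ofReal_lt_top)]
  have h2 : ∀ es : Fin T → E, (∑ g : E → Bool, (Fintype.card E : ENNReal)⁻¹ ^ T *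
        ENNReal.ofReal (∏ f : E, if g f then marg μ univ f else 1 - marg μ univ f) *
        ENNReal.ofReal (∫ r, (Pi.single a 1 : Finset E → ℝ) (glauber μ es r (toSet g) T)
        ∂(Measure.pi (fun _ : Fin T => uni)))).toReal =
      ∑ g : E → Bool, (∏ f : E, if g f then marg μ univ f else 1 - marg μ univ f) *
        ((Fintype.card E : ℝ)⁻¹ ^ T *
        (∫ r, (Pi.single a 1 : Finset E → ℝ) (glauber μ es r (toSet g) T)
        ∂(Measure.pi (fun _ : Fin T => uni)))) := by
    intro es
    rw [ENNReal.toReal_sum (by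
      intro g _
      exact (ENNReal.mul_lt_top (ENNReal.mul_lt_top
        (ENNReal.pow_lt_top (lt_top_iff_ne_top.2 hc))
        ENNReal.ofReal_lt_top) ENNReal.ofReal_lt_top).ne)]
    refine Finset.sum_congr rfl fun g _ => ?_
    rw [ENNReal.toReal_mul, ENNReal.toReal_mul, ENNReal.toReal_ofReal (hpr g),
      ENNReal.toReal_ofReal (hIntNn es g), ENNReal.toReal_pow, ENNReal.toReal_inv]
    simp only [ENNReal.toReal_natCast]
    ring
  rw [Finset.sum_congr rfl fun es _ => h2 es, Finset.sum_comm]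
  have h3 : ∀ g : E → Bool, (∑ es : Fin T → E,
      (∏ f : E, if g f then marg μ univ f else 1 - marg μ univ f) *
        ((Fintype.card E : ℝ)⁻¹ ^ T *
        (∫ r, (Pi.single a 1 : Finset E → ℝ) (glauber μ es r (toSet g) T)
        ∂(Measure.pi (fun _ : Fin T => uni))))) =
      (∏ f : E, if g f then marg μ univ f else 1 - marg μ univ f) *
        (pOp μ ^ T) (Pi.single a 1) (toSet g) := by
    intro g
    rw [← Finset.mul_sum, glauber_law h01]
  rw [Finset.sum_congr rfl fun g _ => h3 g]
  refine Finset.sum_bij' (fun g _ => toSet g) (fun X _ => fun f => decide (f ∈ X)) ?_ ?_ ?_ ?_ ?_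
  · intro g _; simp
  · intro X _; simp
  · intro g _; funext f; simp [toSet]
  · intro X _; ext f; simp [toSet]
  · intro g _
    congr 1
    refine Finset.prod_congr rfl fun f _ => ?_
    simp [toSet]


/-! ### Facts about product weights and domination -/

noncomputable def prW (a b : E → ℝ) (X : Finset E) : ℝ := ∏ f, if f ∈ X then a f else b f

lemma prW_sum (a b : E → ℝ) : ∑ X, prW a b X = ∏ f, (a f + b f) := by
  rw [Finset.prod_add, Finset.powerset_univ]
  refine Finset.sum_congr rfl fun X _ => ?_
  unfold prW
  rw [Finset.prod_ite]
  congr 1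
  · refine Finset.prod_congr ?_ fun _ _ => rfl
    ext; simp
  · refine Finset.prod_congr ?_ fun _ _ => rfl
    ext; simp

lemma prW_nonneg {a b : E → ℝ} (ha : ∀ e, 0 ≤ a e) (hb : ∀ e, 0 ≤ b e) (X : Finset E) :
    0 ≤ prW a b X := by
  refine Finset.prod_nonneg fun f _ => ?_
  split_ifs
  · exact ha f
  · exact hb f

lemma prW_insert (a b : E → ℝ) {X : Finset E} {e : E} (he : e ∉ X) :
    prW a b (insert e X) * b e = prW a b X * a e := by
  unfold prW
  rw [← Finset.mul_prod_erase univ _ (Finset.mem_univ e),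
    ← Finset.mul_prod_erase univ (fun f => if f ∈ X then a f else b f) (Finset.mem_univ e)]
  have : ∏ x ∈ univ.erase e, (if x ∈ insert e X then a x else b x) =
      ∏ x ∈ univ.erase e, (if x ∈ X then a x else b x) := by
    refine Finset.prod_congr rfl fun x hx => ?_
    have hx : x ≠ e := (Finset.mem_erase.1 hx).1
    simp [hx]
  rw [this]
  simp [he]
  ring

lemma dom_lattice {μ : Finset E → ℝ} (hpos : ∀ X, 0 < μ X)
    (hmono : ∀ Y Z e, Y ⊆ Z → marg μ Y e ≤ marg μ Z e)
    (h01 : ∀ X e, 0 ≤ marg μ X e ∧ marg μ X e < 1) (B C : Finset E) (hCB : C ⊆ B)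
    (D : Finset E) (hD : Disjoint D B) :
    μ (C ∪ D) * prW (marg μ univ) (fun e => 1 - marg μ univ e) B ≤
      μ C * prW (marg μ univ) (fun e => 1 - marg μ univ e) (B ∪ D) := by
  induction D using Finset.induction_on with
  | empty => simp
  | insert e D he ih =>
    rw [Finset.disjoint_insert_left] at hD
    have ih := ih hD.2
    have heC : e ∉ C ∪ D := by
      simp only [Finset.mem_union, not_or]
      exact ⟨fun h => hD.1 (hCB h), he⟩
    have heB : e ∉ B ∪ D := by
      simp only [Finset.mem_union, not_or]
      exact ⟨hD.1, he⟩
    rw [Finset.union_insert, Finset.union_insert]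
    set pr := prW (marg μ univ) (fun e => 1 - marg μ univ e) with hpr
    have h1 := prW_insert (marg μ univ) (fun e => 1 - marg μ univ e) heB
    simp only [← hpr] at h1
    have h2 := hmono (C ∪ D) univ e (Finset.subset_univ _)
    have ha := h01 univ e
    set a := marg μ univ e with hadef
    have h3 : μ (insert e (C ∪ D)) * (1 - a) ≤ a * μ (C ∪ D) := by
      unfold marg at h2
      rw [Finset.erase_eq_of_notMem heC, div_le_iff₀ (add_pos (hpos _) (hpos _))] at h2
      linarith
    have hprB : 0 ≤ pr B := prW_nonneg (fun e => (h01 _ e).1)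
      (fun e => by have := (h01 univ e).2; linarith) B
    have hpa : 0 < 1 - a := by linarith [ha.2]
    have : μ (insert e (C ∪ D)) * pr B * (1 - a) ≤ μ C * pr (insert e (B ∪ D)) * (1 - a) := by
      have e1 := mul_le_mul_of_nonneg_right h3 hprB
      have e2 := mul_le_mul_of_nonneg_left ih ha.1
      have e3 : μ C * pr (insert e (B ∪ D)) * (1 - a) = μ C * (pr (B ∪ D) * a) := by
        rw [mul_assoc, h1]
      rw [e3]
      nlinarith
    exact le_of_mul_le_mul_right this hpa

lemma dom_pr {μ : Finset E → ℝ} (hpos : ∀ X, 0 < μ X) (hsum : ∑ X, μ X = 1)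
    (hmono : ∀ Y Z e, Y ⊆ Z → marg μ Y e ≤ marg μ Z e)
    (h01 : ∀ X e, 0 ≤ marg μ X e ∧ marg μ X e < 1) (f : Finset E → ℝ) (hf : Monotone f) :
    ∑ X, μ X * f X ≤ ∑ X, prW (marg μ univ) (fun e => 1 - marg μ univ e) X * f X := by
  have hs : ∑ X, prW (marg μ univ) (fun e => 1 - marg μ univ e) X = 1 := by
    rw [prW_sum]; simp
  have h0 : 0 ≤ prW (marg μ univ) (fun e => 1 - marg μ univ e) := fun X =>
    prW_nonneg (fun e => (h01 _ e).1)
      (fun e => by have := (h01 univ e).2; linarith) X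
  have := holley (μ := fun X => f X - f ∅) (f := μ)
    (g := prW (marg μ univ) (fun e => 1 - marg μ univ e))
    (fun X => sub_nonneg.2 (hf (Finset.empty_subset X))) (fun X => (hpos X).le) h0
    (fun X Y h => sub_le_sub_right (hf h) _) (by rw [hs, hsum]) (by
      intro A B
      have := dom_lattice hpos hmono h01 B (A ∩ B) Finset.inter_subset_right (A \ B)
        Finset.sdiff_disjoint
      have e1 : A ∩ B ∪ A \ B = A := by
        rw [Finset.union_comm]; exact Finset.sdiff_union_inter A B
      have e2 : B ∪ A \ B = A ∪ B := by
        rw [Finset.union_sdiff_self_eq_union, Finset.union_comm]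
      rw [e1, e2] at this
      exact this)
  simp only [sub_mul, Finset.sum_sub_distrib, ← Finset.mul_sum, hs, hsum] at this
  simp only [mul_comm (f _)] at this
  linarith

lemma closed_prob {μ : Finset E → ℝ} (hpos : ∀ X, 0 < μ X) (hsum : ∑ X, μ X = 1) {c : ℝ}
    (hc0 : 0 ≤ c) (hc : ∀ X e, 1 - marg μ X e ≤ c) (F : Finset E) :
    ∑ Y, μ Y * (if Disjoint F Y then 1 else 0) ≤ c ^ F.card := by
  induction F using Finset.induction_on with
  | empty => simp [hsum]
  | insert e F he ih =>
    rw [Finset.card_insert_of_notMem he, pow_succ]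
    refine le_trans ?_ (mul_le_mul_of_nonneg_right ih hc0)
    rw [sum_split e, sum_split e, Finset.sum_mul]
    refine Finset.sum_le_sum fun X hX => ?_
    have heX : e ∉ X := fun h => by
      have := Finset.mem_powerset.1 hX h
      simp at this
    have h1 : Disjoint (insert e F) X ↔ Disjoint F X := by
      rw [Finset.disjoint_insert_left]; simp [heX]
    have h2 : ¬ Disjoint (insert e F) (insert e X) := by
      rw [Finset.disjoint_insert_left]; simp
    have h3 : Disjoint F (insert e X) ↔ Disjoint F X := by
      rw [Finset.disjoint_insert_right]; simp [he]
    simp only [h1, h2, h3, if_false, mul_zero, add_zero]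
    by_cases hd : Disjoint F X
    · simp only [hd, if_true, mul_one]
      have := hc X e
      unfold marg at this
      rw [Finset.erase_eq_of_notMem heX] at this
      have hp := add_pos (hpos (insert e X)) (hpos X)
      have h4 : 1 - μ (insert e X) / (μ (insert e X) + μ X) = μ X / (μ (insert e X) + μ X) := by
        field_simp; ring
      rw [h4, div_le_iff₀ hp] at this
      linarith
    · simp [hd]

/-! ### The percolation witness -/

noncomputable def Wx (ends : E → V × V) (w c : ℝ) (x : V) (Y : Finset E) : ℝ :=
  ∑ A, prW (fun _ : E => 1 - w) (fun _ => w) A *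
    (if Disjoint (cutE ends (comp ends A x)) Y then (c⁻¹) ^ (cutE ends (comp ends A x)).card else 0)

lemma Wx_term_nonneg {ends : E → V × V} {w c : ℝ} (hw0 : 0 ≤ w) (hw1 : w ≤ 1) (hc : 0 ≤ c)
    (x : V) (Y A : Finset E) : 0 ≤ prW (fun _ : E => 1 - w) (fun _ => w) A *
    (if Disjoint (cutE ends (comp ends A x)) Y then (c⁻¹) ^ (cutE ends (comp ends A x)).card
      else 0) := by
  refine mul_nonneg (prW_nonneg (fun _ => by linarith) (fun _ => hw0) A) ?_
  split_ifs <;> positivity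

lemma Wx_nonneg {ends : E → V × V} {w c : ℝ} (hw0 : 0 ≤ w) (hw1 : w ≤ 1) (hc : 0 ≤ c)
    (x : V) (Y : Finset E) : 0 ≤ Wx ends w c x Y :=
  Finset.sum_nonneg fun A _ => Wx_term_nonneg hw0 hw1 hc x Y A

lemma Wx_anti {ends : E → V × V} {w c : ℝ} (hw0 : 0 ≤ w) (hw1 : w ≤ 1) (hc : 0 ≤ c)
    (x : V) {Y Z : Finset E} (hYZ : Y ⊆ Z) : Wx ends w c x Z ≤ Wx ends w c x Y := by
  refine Finset.sum_le_sum fun A _ => ?_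
  refine mul_le_mul_of_nonneg_left ?_ (prW_nonneg (fun _ => by linarith) (fun _ => hw0) A)
  by_cases h : Disjoint (cutE ends (comp ends A x)) Z
  · rw [if_pos h, if_pos (h.mono_right hYZ)]
  · rw [if_neg h]
    split_ifs <;> positivity

lemma Wx_exp {μ : Finset E → ℝ} (hpos : ∀ X, 0 < μ X) (hsum : ∑ X, μ X = 1) {c w : ℝ}
    (hc0 : 0 < c) (hc : ∀ X e, 1 - marg μ X e ≤ c) (hw0 : 0 ≤ w) (hw1 : w ≤ 1)
    (ends : E → V × V) (x : V) :
    ∑ Y, μ Y * Wx ends w c x Y ≤ 1 := by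
  have hs : ∑ A, prW (fun _ : E => 1 - w) (fun _ => w) A = 1 := by
    rw [prW_sum]; simp
  unfold Wx
  simp only [Finset.mul_sum]
  rw [Finset.sum_comm]
  refine le_trans ?_ hs.le
  refine Finset.sum_le_sum fun A _ => ?_
  have h0 := prW_nonneg (a := fun _ : E => 1 - w) (b := fun _ => w)
    (fun _ => by linarith) (fun _ => hw0) A
  have h1 := closed_prob hpos hsum hc0.le hc (cutE ends (comp ends A x))
  set k := (cutE ends (comp ends A x)).card
  have e1 : ∑ Y, μ Y * (prW (fun _ : E => 1 - w) (fun _ => w) A *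
      (if Disjoint (cutE ends (comp ends A x)) Y then (c⁻¹) ^ k else 0)) =
      prW (fun _ : E => 1 - w) (fun _ => w) A * ((c⁻¹) ^ k *
      ∑ Y, μ Y * (if Disjoint (cutE ends (comp ends A x)) Y then 1 else 0)) := by
    rw [Finset.mul_sum, Finset.mul_sum]
    refine Finset.sum_congr rfl fun Y _ => ?_
    split_ifs <;> ring
  rw [e1]
  have e2 : (c⁻¹) ^ k * ∑ Y, μ Y * (if Disjoint (cutE ends (comp ends A x)) Y then 1 else 0)
      ≤ 1 := by
    refine (mul_le_mul_of_nonneg_left h1 (by positivity)).trans ?_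
    rw [← mul_pow, inv_mul_cancel₀ hc0.ne', one_pow]
  exact mul_le_of_le_one_right h0 e2

lemma Wx_lower (ends : E → V × V) {w c : ℝ} (hw0 : 0 ≤ w) (hw1 : w ≤ 1) (hc : 0 < c)
    (x : V) (Y : Finset E) :
    (1 - w) ^ (comp ends Y x).card * (w / c) ^ (cutE ends (comp ends Y x)).card
      ≤ Wx ends w c x Y := by
  obtain ⟨τ, hτY, hτ, hτc⟩ := exists_span ends Y x
  set S := comp ends Y x with hS
  have hcutY : Disjoint (cutE ends S) Y := by
    rw [Finset.disjoint_left]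
    intro e he heY
    exact not_mem_cut_comp heY he
  have hcτ : ∀ f ∈ cutE ends S, f ∉ τ := fun f hf hfτ =>
    Finset.disjoint_left.1 hcutY hf (hτY hfτ)
  have hsum := prW_sum (fun f : E => if f ∈ cutE ends S then 0 else 1 - w)
    (fun f => if f ∈ τ then 0 else w)
  have hprod : ∏ f : E, ((if f ∈ cutE ends S then 0 else 1 - w) + (if f ∈ τ then 0 else w)) =
      w ^ (cutE ends S).card * (1 - w) ^ τ.card := by
    have : ∀ f : E, ((if f ∈ cutE ends S then 0 else 1 - w) + (if f ∈ τ then 0 else w)) =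
        (if f ∈ cutE ends S then w else 1) * (if f ∈ τ then 1 - w else 1) := by
      intro f
      by_cases h1 : f ∈ cutE ends S
      · simp [h1, hcτ f h1]
      · by_cases h2 : f ∈ τ <;> simp [h1, h2]
    rw [Finset.prod_congr rfl fun f _ => this f, Finset.prod_mul_distrib]
    congr 1
    · rw [Finset.prod_ite_mem]; simp
    · rw [Finset.prod_ite_mem]; simp
  have hterm : ∀ A : Finset E, prW (fun f : E => if f ∈ cutE ends S then 0 else 1 - w)
      (fun f => if f ∈ τ then 0 else w) A * (c⁻¹) ^ (cutE ends S).card ≤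
      prW (fun _ : E => 1 - w) (fun _ => w) A *
    (if Disjoint (cutE ends (comp ends A x)) Y then (c⁻¹) ^ (cutE ends (comp ends A x)).card
      else 0) := by
    intro A
    by_cases hA : τ ⊆ A ∧ Disjoint (cutE ends S) A
    · have hcomp : comp ends A x = S := by
        apply Finset.Subset.antisymm
        · exact comp_subset_of_cut (self_mem_comp ..) fun e he h =>
            Finset.disjoint_left.1 hA.2 h he
        · rw [← hτ]; exact comp_mono hA.1 x
      rw [hcomp, if_pos hcutY]
      refine mul_le_mul_of_nonneg_right ?_ (by positivity)
      refine le_of_eq ?_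
      refine Finset.prod_congr rfl fun f _ => ?_
      by_cases hf : f ∈ A
      · have : f ∉ cutE ends S := fun h => Finset.disjoint_left.1 hA.2 h hf
        simp [hf, this]
      · have : f ∉ τ := fun h => hf (hA.1 h)
        simp [hf, this]
    · have : prW (fun f : E => if f ∈ cutE ends S then 0 else 1 - w)
        (fun f => if f ∈ τ then 0 else w) A = 0 := by
        unfold prW
        rw [Finset.prod_eq_zero_iff]
        rw [not_and_or] at hA
        rcases hA with h | h
        · rw [Finset.not_subset] at h
          obtain ⟨f, h1, h2⟩ := h
          exact ⟨f, Finset.mem_univ f, by simp [h1, h2]⟩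
        · rw [Finset.not_disjoint_iff] at h
          obtain ⟨f, h1, h2⟩ := h
          exact ⟨f, Finset.mem_univ f, by simp [h1, h2]⟩
      rw [this, zero_mul]
      exact Wx_term_nonneg hw0 hw1 hc.le x Y A
  have := Finset.sum_le_sum fun A (_ : A ∈ (univ : Finset (Finset E))) => hterm A
  rw [← Finset.sum_mul, hsum, hprod] at this
  refine le_trans ?_ this
  have h1 : (1 - w) ^ S.card ≤ (1 - w) ^ τ.card :=
    pow_le_pow_of_le_one (by linarith) (by linarith) hτc
  have h2 : (w / c) ^ (cutE ends S).card = w ^ (cutE ends S).card * c⁻¹ ^ (cutE ends S).card := by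
    rw [← mul_pow]; rfl
  rw [h2]
  have := mul_le_mul_of_nonneg_right h1
    (show 0 ≤ w ^ (cutE ends S).card * c⁻¹ ^ (cutE ends S).card by positivity)
  linarith

/-! ### Bridge sum -/

lemma bridge_sum {ι : Type*} (s : Finset ι) (a : ι → ℕ)
    (h : ∀ k, (s.filter (fun e => a e ≤ k)).card ≤ 2 * k) {L : ℝ} (hL0 : 0 ≤ L) (hL1 : L < 1) :
    ∑ e ∈ s, L ^ a e ≤ 2 / (1 - L) := by
  classical
  have key : ∀ K : ℕ, ∑ e ∈ s.filter (fun e => a e ≤ K), L ^ a e +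
      (2 * K - ((s.filter (fun e => a e ≤ K)).card : ℝ)) * L ^ K ≤
      2 * ∑ k ∈ Finset.range (K + 1), L ^ k := by
    intro K
    induction K with
    | zero =>
      have h0 := h 0
      simp only [mul_zero, Nat.le_zero, Finset.card_eq_zero] at h0
      simp only [Nat.le_zero]
      rw [h0]; simp
    | succ K ih =>
      have hsplit : s.filter (fun e => a e ≤ K + 1) =
          s.filter (fun e => a e ≤ K) ∪ s.filter (fun e => a e = K + 1) := by
        ext e; simp only [Finset.mem_filter, Finset.mem_union, ← and_or_left]
        refine and_congr_right fun _ => ?_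
        omega
      have hdis : Disjoint (s.filter (fun e => a e ≤ K)) (s.filter (fun e => a e = K + 1)) := by
        rw [Finset.disjoint_filter]; intro e _ h1 h2; omega
      rw [Finset.sum_range_succ, hsplit, Finset.sum_union hdis, Finset.card_union_of_disjoint hdis]
      have e1 : ∑ e ∈ s.filter (fun e => a e = K + 1), L ^ a e =
          ((s.filter (fun e => a e = K + 1)).card : ℝ) * L ^ (K + 1) := by
        rw [Finset.sum_congr rfl (g := fun _ => L ^ (K + 1)) (fun e he => by
          rw [(Finset.mem_filter.1 he).2])]
        simp
      rw [e1]
      have hc : ((s.filter (fun e => a e ≤ K)).card : ℝ) ≤ 2 * K := by exact_mod_cast h K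
      have hp : L ^ (K + 1) ≤ L ^ K := pow_le_pow_of_le_one hL0 hL1.le (Nat.le_succ K)
      have := mul_le_mul_of_nonneg_left hp (sub_nonneg.2 hc)
      push_cast
      nlinarith
  have hk := key (s.sup a)
  have hf : s.filter (fun e => a e ≤ s.sup a) = s :=
    Finset.filter_true_of_mem fun e he => Finset.le_sup he
  have hh := h (s.sup a)
  rw [hf] at hk hh
  have hc : (s.card : ℝ) ≤ 2 * (s.sup a : ℕ) := by exact_mod_cast hh
  have h0 : 0 ≤ (2 * ((s.sup a : ℕ) : ℝ) - s.card) * L ^ (s.sup a) :=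
    mul_nonneg (by linarith) (by positivity)
  have hg : ∑ k ∈ Finset.range (s.sup a + 1), L ^ k ≤ 1 / (1 - L) := by
    rw [le_div_iff₀ (by linarith), geom_sum_mul_neg]
    have : 0 ≤ L ^ (s.sup a + 1) := by positivity
    linarith
  have : 2 / (1 - L) = 2 * (1 / (1 - L)) := by ring
  linarith

lemma mul_pow_le_geom (s : ℕ) {L : ℝ} (hL0 : 0 ≤ L) (hL1 : L < 1) :
    (s : ℝ) * L ^ s ≤ 1 / (1 - L) := by
  have h1 : (s : ℝ) * L ^ s ≤ ∑ k ∈ Finset.range s, L ^ k := by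
    have : (s : ℝ) * L ^ s = ∑ k ∈ Finset.range s, L ^ s := by simp
    rw [this]
    refine Finset.sum_le_sum fun k hk => ?_
    exact pow_le_pow_of_le_one hL0 hL1.le (Finset.mem_range.1 hk).le
  refine h1.trans ?_
  rw [le_div_iff₀ (by linarith), geom_sum_mul_neg]
  have : 0 ≤ L ^ s := by positivity
  linarith

lemma infl_sum_le' (ends : E → V × V) {L : ℝ} (hL0 : 0 ≤ L) (Y : Finset E) (x : V) :
    ∑ e, infl ends L (Y.erase e) e x ≤
      (cutE ends (comp ends Y x)).card * L ^ (comp ends Y x).card +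
        ∑ e ∈ brid ends Y x, L ^ (comp ends (Y.erase e) x).card := by
  have h1 : ∀ e, infl ends L (Y.erase e) e x ≤
      (if e ∈ cutE ends (comp ends Y x) then L ^ (comp ends Y x).card else 0) +
      (if e ∈ brid ends Y x then L ^ (comp ends (Y.erase e) x).card else 0) := by
    intro e
    by_cases he : e ∈ Y
    · have : 0 ≤ (if e ∈ cutE ends (comp ends Y x) then L ^ (comp ends Y x).card else 0) := by
        split_ifs <;> positivity
      have h2 : infl ends L (Y.erase e) e x =
          (if e ∈ brid ends Y x then L ^ (comp ends (Y.erase e) x).card else 0) := by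
        unfold infl brid
        simp [he]
      linarith
    · have : 0 ≤ (if e ∈ brid ends Y x then L ^ (comp ends (Y.erase e) x).card else 0) := by
        split_ifs <;> positivity
      rw [Finset.erase_eq_of_notMem he] at this ⊢
      unfold infl
      linarith
  refine (Finset.sum_le_sum fun e _ => h1 e).trans ?_
  rw [Finset.sum_add_distrib]
  refine add_le_add ?_ ?_
  · rw [Finset.sum_ite_mem]; simp
  · rw [Finset.sum_ite_mem, Finset.univ_inter]

lemma infl_sum_le (ends : E → V × V) {L : ℝ} (hL0 : 0 ≤ L) (hL1 : L < 1) (Y : Finset E) (x : V) :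
    ∑ e, infl ends L (Y.erase e) e x ≤
      (cutE ends (comp ends Y x)).card * L ^ (comp ends Y x).card + 2 / (1 - L) :=
  (infl_sum_le' ends hL0 Y x).trans (add_le_add le_rfl
    (bridge_sum _ _ (brid_count ends Y x) hL0 hL1))

/-! ### Marginals of the random cluster model -/

lemma rc_marg_bounds (ends : E → V × V) (p : E → ℝ) (lam : V → ℝ)
    (hp : ∀ e, p e ∈ Set.Ioo (0 : ℝ) 1) (hlam : ∀ v, lam v ∈ Set.Ico (0 : ℝ) 1)
    (X : Finset E) (e : E) :
    0 ≤ marg (rcProb ends p lam univ) X e ∧ marg (rcProb ends p lam univ) X e < 1 ∧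
      1 - marg (rcProb ends p lam univ) X e ≤ 2 * (1 - p e) := by
  rw [marg_eq ends p lam hp hlam]
  obtain ⟨h0, h1⟩ := hp e
  obtain ⟨k1, k2⟩ := K0_bounds ends lam hlam (X.erase e) e
  set K := K0 ends lam (X.erase e) e
  have hq : 0 < 1 - p e := by linarith
  have hqK : 0 < (1 - p e) * K := by positivity
  have hD : 1 ≤ p e + (1 - p e) * K := by nlinarith
  have hD0 : 0 < p e + (1 - p e) * K := by linarith
  refine ⟨by positivity, ?_, ?_⟩
  · rw [div_lt_one hD0]; linarith
  · have : 1 - p e / (p e + (1 - p e) * K) = (1 - p e) * K / (p e + (1 - p e) * K) := by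
      field_simp; ring
    rw [this, div_le_iff₀ hD0]
    nlinarith

lemma rc_marg_mono (ends : E → V × V) (p : E → ℝ) (lam : V → ℝ)
    (hp : ∀ e, p e ∈ Set.Ioo (0 : ℝ) 1) (hlam : ∀ v, lam v ∈ Set.Ico (0 : ℝ) 1)
    (Y Z : Finset E) (e : E) (h : Y ⊆ Z) :
    marg (rcProb ends p lam univ) Y e ≤ marg (rcProb ends p lam univ) Z e := by
  rw [marg_eq ends p lam hp hlam, marg_eq ends p lam hp hlam]
  obtain ⟨h0, h1⟩ := hp e
  obtain ⟨k1, k2⟩ := K0_bounds ends lam hlam (Z.erase e) e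
  have hK := K0_anti ends lam hlam (Finset.erase_subset_erase e h) e
  have hq : 0 < 1 - p e := by linarith
  have := mul_le_mul_of_nonneg_left hK hq.le
  have h3 : 0 < (1 - p e) * K0 ends lam (Z.erase e) e := by positivity
  exact div_le_div_of_nonneg_left h0.le (by linarith) (by linarith)

lemma rc_marg_diff (ends : E → V × V) (p : E → ℝ) (lam : V → ℝ)
    (hp : ∀ e, p e ∈ Set.Ioo (0 : ℝ) 1) (hlam : ∀ v, lam v ∈ Set.Ico (0 : ℝ) 1)
    (Y Z : Finset E) (e : E) (h : Y ⊆ Z) :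
    marg (rcProb ends p lam univ) Z e - marg (rcProb ends p lam univ) Y e ≤
      (1 - p e) * (K0 ends lam (Y.erase e) e - K0 ends lam (Z.erase e) e) := by
  rw [marg_eq ends p lam hp hlam, marg_eq ends p lam hp hlam]
  obtain ⟨h0, h1⟩ := hp e
  obtain ⟨k1, k2⟩ := K0_bounds ends lam hlam (Z.erase e) e
  obtain ⟨k3, k4⟩ := K0_bounds ends lam hlam (Y.erase e) e
  have hK := K0_anti ends lam hlam (Finset.erase_subset_erase e h) e
  set K := K0 ends lam (Z.erase e) e
  set K' := K0 ends lam (Y.erase e) e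
  have hq : 0 < 1 - p e := by linarith
  have hD : 1 ≤ p e + (1 - p e) * K := by nlinarith
  have hD' : 1 ≤ p e + (1 - p e) * K' := by nlinarith
  rw [div_sub_div _ _ (by linarith) (by linarith), div_le_iff₀ (by nlinarith)]
  have h5 : 0 ≤ (1 - p e) * (K' - K) := mul_nonneg hq.le (by linarith)
  have h6 : 1 ≤ (p e + (1 - p e) * K) * (p e + (1 - p e) * K') := by nlinarith
  have h7 := mul_le_mul_of_nonneg_left h6 h5
  nlinarith

/-! ### The drift estimate -/

noncomputable def Wt (ends : E → V × V) (w c : ℝ) (Y : Finset E) : ℝ := ∑ x, Wx ends w c x Y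

lemma cut_le_log (ends : E → V × V) {q w : ℝ} (hq : 0 < q) (hw : w = 2 * exp 1 * q)
    (hw1 : w ≤ 1 / 2) (x : V) (Y : Finset E) :
    ((cutE ends (comp ends Y x)).card : ℝ) ≤
      Real.log (Wt ends w (2 * q) Y) + 2 * w * (comp ends Y x).card := by
  have hw0 : 0 < w := by rw [hw]; positivity
  have h1 := Wx_lower ends hw0.le (by linarith) (show 0 < 2 * q by linarith) x Y
  have hwc : w / (2 * q) = exp 1 := by rw [hw]; field_simp
  rw [hwc, ← Real.exp_nat_mul, mul_one] at h1
  have h2 : Wx ends w (2 * q) x Y ≤ Wt ends w (2 * q) Y := by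
    unfold Wt
    exact Finset.single_le_sum (f := fun x => Wx ends w (2 * q) x Y)
      (fun y _ => Wx_nonneg hw0.le (by linarith) (by linarith) y Y) (Finset.mem_univ x)
  have h3 : exp (-(2 * w)) ≤ 1 - w := by
    have hp : 0 < 1 - w := by linarith
    rw [← Real.le_log_iff_exp_le hp]
    refine le_trans ?_ (Real.one_sub_inv_le_log_of_pos hp)
    have : (1 - w)⁻¹ ≤ 1 + 2 * w := by
      rw [inv_le_iff_one_le_mul₀ hp]
      nlinarith
    linarith
  have h4 : exp (-(2 * w)) ^ (comp ends Y x).card ≤ (1 - w) ^ (comp ends Y x).card :=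
    pow_le_pow_left₀ (exp_pos _).le h3 _
  rw [← Real.exp_nat_mul] at h4
  have h5 : exp (((cutE ends (comp ends Y x)).card : ℝ) - 2 * w * (comp ends Y x).card) ≤
      Wt ends w (2 * q) Y := by
    refine le_trans ?_ (h1.trans h2)
    have : ((cutE ends (comp ends Y x)).card : ℝ) - 2 * w * (comp ends Y x).card =
        ((comp ends Y x).card : ℝ) * (-(2 * w)) + (cutE ends (comp ends Y x)).card := by ring
    rw [this, Real.exp_add]
    exact mul_le_mul_of_nonneg_right h4 (exp_pos _).le
  have h6 : 0 < Wt ends w (2 * q) Y := lt_of_lt_of_le (exp_pos _) h5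
  have := (Real.le_log_iff_exp_le h6).2 h5
  linarith

lemma Wt_anti {ends : E → V × V} {w c : ℝ} (hw0 : 0 ≤ w) (hw1 : w ≤ 1) (hc : 0 ≤ c)
    {Y Z : Finset E} (hYZ : Y ⊆ Z) : Wt ends w c Z ≤ Wt ends w c Y :=
  Finset.sum_le_sum fun x _ => Wx_anti hw0 hw1 hc x hYZ

lemma Wt_nonneg {ends : E → V × V} {w c : ℝ} (hw0 : 0 ≤ w) (hw1 : w ≤ 1) (hc : 0 ≤ c)
    (Y : Finset E) : 0 ≤ Wt ends w c Y :=
  Finset.sum_nonneg fun x _ => Wx_nonneg hw0 hw1 hc x Y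

lemma Wt_exp {μ : Finset E → ℝ} (hpos : ∀ X, 0 < μ X) (hsum : ∑ X, μ X = 1) {c w : ℝ}
    (hc0 : 0 < c) (hc : ∀ X e, 1 - marg μ X e ≤ c) (hw0 : 0 ≤ w) (hw1 : w ≤ 1)
    (ends : E → V × V) :
    ∑ Y, μ Y * Wt ends w c Y ≤ Fintype.card V := by
  unfold Wt
  simp only [Finset.mul_sum]
  rw [Finset.sum_comm]
  refine (Finset.sum_le_sum fun x _ => Wx_exp hpos hsum hc0 hc hw0 hw1 ends x).trans ?_
  simp

lemma step_drift (ends : E → V × V) (p : E → ℝ) (lam : V → ℝ)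
    (hp : ∀ e, p e ∈ Set.Ioo (0 : ℝ) 1) (hlam : ∀ v, lam v ∈ Set.Ico (0 : ℝ) 1)
    {q L : ℝ} (hqp : ∀ e, 1 - p e ≤ q) (hL : ∀ v, lam v ≤ L) (hL0 : 0 ≤ L)
    (Y : Finset E) (f : E) :
    ∑ e, marg (rcProb ends p lam univ) (insert f Y) e - ∑ e, marg (rcProb ends p lam univ) Y e ≤
      q * (∑ e, infl ends L (Y.erase e) e (ends f).1 +
        ∑ e, infl ends L (Y.erase e) e (ends f).2) := by
  rw [← Finset.sum_sub_distrib, ← Finset.sum_add_distrib, Finset.mul_sum]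
  refine Finset.sum_le_sum fun e _ => ?_
  have hx := infl_nonneg ends hL0 (Y.erase e) e (ends f).1
  have hy := infl_nonneg ends hL0 (Y.erase e) e (ends f).2
  have hq : 0 < q := by linarith [hqp f, (hp f).2]
  by_cases hef : e = f
  · subst hef
    rw [marg_insert, sub_self]
    exact mul_nonneg hq.le (by linarith)
  · have h1 := rc_marg_diff ends p lam hp hlam Y (insert f Y) e (Finset.subset_insert f Y)
    have h2 := K0_lip ends lam hlam hL hL0 (Y.erase e) e f
    rw [Finset.erase_insert_of_ne (Ne.symm hef)] at h1
    refine h1.trans ?_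
    have h3 := mul_le_mul_of_nonneg_left h2 (show 0 ≤ 1 - p e by linarith [(hp e).2])
    refine h3.trans (mul_le_mul_of_nonneg_right (hqp e) (by linarith))

lemma good_step (ends : E → V × V) (p : E → ℝ) (lam : V → ℝ)
    (hp : ∀ e, p e ∈ Set.Ioo (0 : ℝ) 1) (hlam : ∀ v, lam v ∈ Set.Ico (0 : ℝ) 1)
    {q L w B : ℝ} (hqp : ∀ e, 1 - p e ≤ q) (hL : ∀ v, lam v ≤ L) (hL0 : 0 ≤ L) (hL1 : L < 1)
    (hw : w = 2 * exp 1 * q) (hw1 : w ≤ 1 / 2) (hB0 : 0 ≤ B)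
    (hB : 2 * q * (B + (2 * w + 2) / (1 - L)) ≤ 1 / 2)
    (Y : Finset E) (f : E) (hY : Real.log (Wt ends w (2 * q) Y) ≤ B) :
    ∑ e, marg (rcProb ends p lam univ) (insert f Y) e - ∑ e, marg (rcProb ends p lam univ) Y e ≤
      1 / 2 := by
  have hq : 0 < q := by linarith [hqp f, (hp f).2]
  have hw0 : 0 < w := by rw [hw]; positivity
  have key : ∀ z, ∑ e, infl ends L (Y.erase e) e z ≤ B + (2 * w + 2) / (1 - L) := by
    intro z
    refine (infl_sum_le ends hL0 hL1 Y z).trans ?_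
    have h1 := cut_le_log ends hq hw hw1 z Y
    have h2 := mul_pow_le_geom (comp ends Y z).card hL0 hL1
    have h3 : L ^ (comp ends Y z).card ≤ 1 := pow_le_one₀ hL0 hL1.le
    have h4 : 0 ≤ L ^ (comp ends Y z).card := by positivity
    set P := L ^ (comp ends Y z).card
    have h5 : ((cutE ends (comp ends Y z)).card : ℝ) * P ≤
        (B + 2 * w * (comp ends Y z).card) * P :=
      mul_le_mul_of_nonneg_right (by linarith) h4
    have h6 : B * P ≤ B := mul_le_of_le_one_right hB0 h3
    have h7 := mul_le_mul_of_nonneg_left h2 (show 0 ≤ 2 * w by linarith)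
    have h8 : (2 * w + 2) / (1 - L) = 2 * w * (1 / (1 - L)) + 2 / (1 - L) := by ring
    rw [h8]
    linarith
  refine (step_drift ends p lam hp hlam hqp hL hL0 Y f).trans ?_
  have := mul_le_mul_of_nonneg_left (add_le_add (key (ends f).1) (key (ends f).2)) hq.le
  linarith

lemma good_drift (ends : E → V × V) (p : E → ℝ) (lam : V → ℝ)
    (hp : ∀ e, p e ∈ Set.Ioo (0 : ℝ) 1) (hlam : ∀ v, lam v ∈ Set.Ico (0 : ℝ) 1)
    {q L w Λ : ℝ} (hq : 0 < q) (hqp : ∀ e, 1 - p e ≤ q) (hL : ∀ v, lam v ≤ L) (hL0 : 0 ≤ L)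
    (hL1 : L < 1)
    (hw : w = 2 * exp 1 * q) (hw1 : w ≤ 1 / 2) (hΛ : 1 ≤ Λ)
    (hB : 2 * q * (Real.log (Λ ^ 2) + (2 * w + 2) / (1 - L)) ≤ 1 / 2)
    (Y : Finset E) (hY : Wt ends w (2 * q) Y ≤ Λ ^ 2) (D : Finset E) (hD : Disjoint D Y) :
    ∑ e, marg (rcProb ends p lam univ) (D ∪ Y) e - ∑ e, marg (rcProb ends p lam univ) Y e ≤
      1 / 2 * D.card := by
  have hw0 : 0 < w := by rw [hw]; positivity
  induction D using Finset.induction_on with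
  | empty => simp
  | insert f D hf ih =>
    rw [Finset.disjoint_insert_left] at hD
    have ih := ih hD.2
    rw [Finset.insert_union, Finset.card_insert_of_notMem hf]
    have h1 : Wt ends w (2 * q) (D ∪ Y) ≤ Λ ^ 2 :=
      (Wt_anti hw0.le (by linarith) (by linarith) Finset.subset_union_right).trans hY
    have h2 : Real.log (Wt ends w (2 * q) (D ∪ Y)) ≤ Real.log (Λ ^ 2) := by
      rcases (Wt_nonneg (ends := ends) hw0.le (by linarith) (show 0 ≤ 2 * q by linarith)
        (D ∪ Y)).eq_or_lt with h | h
      · rw [← h, Real.log_zero]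
        exact Real.log_nonneg (one_le_pow₀ hΛ)
      · exact Real.log_le_log h h1
    have := good_step ends p lam hp hlam hqp hL hL0 hL1 hw hw1
      (Real.log_nonneg (one_le_pow₀ hΛ)) hB (D ∪ Y) f h2
    push_cast
    linarith

lemma bad_drift (ends : E → V × V) (p : E → ℝ) (lam : V → ℝ)
    (hp : ∀ e, p e ∈ Set.Ioo (0 : ℝ) 1) (hlam : ∀ v, lam v ∈ Set.Ico (0 : ℝ) 1)
    {q : ℝ} (hq : 0 < q) (hqp : ∀ e, 1 - p e ≤ q) (Y Z : Finset E) (hYZ : Y ⊆ Z) :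
    ∑ e, marg (rcProb ends p lam univ) Z e - ∑ e, marg (rcProb ends p lam univ) Y e ≤
      q * ∑ x, (((cutE ends (comp ends Y x)).card : ℝ) + (comp ends Y x).card) := by
  have h1 : ∀ e, marg (rcProb ends p lam univ) Z e - marg (rcProb ends p lam univ) Y e ≤
      q * ∑ x, infl ends 1 (Y.erase e) e x := by
    intro e
    have hnn : ∀ x ∈ (univ : Finset V), 0 ≤ infl ends 1 (Y.erase e) e x :=
      fun x _ => infl_nonneg ends zero_le_one _ _ _
    refine (rc_marg_diff ends p lam hp hlam Y Z e hYZ).trans ?_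
    obtain ⟨k1, k2⟩ := K0_bounds ends lam hlam (Z.erase e) e
    obtain ⟨k3, k4⟩ := K0_bounds ends lam hlam (Y.erase e) e
    have hpe : 0 ≤ 1 - p e := by linarith [(hp e).2]
    by_cases hc : Cn ends (Y.erase e) (ends e).1 (ends e).2
    · have : K0 ends lam (Y.erase e) e = 1 := by simp [K0, hc]
      rw [this]
      have h2 : (1 - p e) * (1 - K0 ends lam (Z.erase e) e) ≤ 0 :=
        mul_nonpos_of_nonneg_of_nonpos hpe (by linarith)
      exact h2.trans (mul_nonneg hq.le (Finset.sum_nonneg hnn))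
    · have h2 : infl ends 1 (Y.erase e) e (ends e).1 = 1 := by
        unfold infl
        rw [if_pos, one_pow]
        rw [mem_cutE]
        intro h
        exact hc (mem_comp'.1 (h.1 (self_mem_comp ..)))
      have h3 := Finset.single_le_sum hnn (Finset.mem_univ (ends e).1)
      rw [h2] at h3
      refine (mul_le_mul_of_nonneg_left (show K0 ends lam (Y.erase e) e -
        K0 ends lam (Z.erase e) e ≤ 1 by linarith) hpe).trans ?_
      exact mul_le_mul (hqp e) h3 zero_le_one hq.le
  rw [← Finset.sum_sub_distrib]
  refine (Finset.sum_le_sum fun e _ => h1 e).trans ?_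
  rw [← Finset.mul_sum, Finset.sum_comm]
  refine mul_le_mul_of_nonneg_left (Finset.sum_le_sum fun x _ => ?_) hq.le
  refine (infl_sum_le' ends zero_le_one Y x).trans ?_
  simp only [one_pow, mul_one, Finset.sum_const, nsmul_eq_mul]
  have : ((brid ends Y x).card : ℝ) ≤ (comp ends Y x).card := by
    exact_mod_cast brid_card_le ends Y x
  linarith

lemma drift (ends : E → V × V) (p : E → ℝ) (lam : V → ℝ)
    (hp : ∀ e, p e ∈ Set.Ioo (0 : ℝ) 1) (hlam : ∀ v, lam v ∈ Set.Ico (0 : ℝ) 1)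
    {q L w Λ : ℝ} (hq : 0 < q) (hqp : ∀ e, 1 - p e ≤ q) (hL : ∀ v, lam v ≤ L) (hL0 : 0 ≤ L)
    (hL1 : L < 1) (hn : 1 ≤ Fintype.card V)
    (hw : w = 2 * exp 1 * q) (hw1 : w ≤ 1 / 2) (hΛ : 1 ≤ Λ)
    (hB : 2 * q * (Real.log (Λ ^ 2) + (2 * w + 2) / (1 - L)) ≤ 1 / 2)
    (Y Z : Finset E) (hYZ : Y ⊆ Z) :
    ∑ e, marg (rcProb ends p lam univ) Z e - ∑ e, marg (rcProb ends p lam univ) Y e ≤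
      (1 / 2) * ((Z.card : ℝ) - Y.card) +
        4 * q * (Fintype.card V : ℝ) ^ 2 / Λ * Wt ends w (2 * q) Y := by
  have hw0 : 0 < w := by rw [hw]; positivity
  have hW0 := Wt_nonneg (ends := ends) hw0.le (by linarith) (show 0 ≤ 2 * q by linarith) Y
  have hcard : (Y.card : ℝ) ≤ Z.card := by exact_mod_cast Finset.card_le_card hYZ
  by_cases hY : Wt ends w (2 * q) Y ≤ Λ ^ 2
  · have := good_drift ends p lam hp hlam hq hqp hL hL0 hL1 hw hw1 hΛ hB Y hY (Z \ Y)
      Finset.sdiff_disjoint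
    rw [Finset.sdiff_union_of_subset hYZ, Finset.card_sdiff_of_subset hYZ,
      Nat.cast_sub (Finset.card_le_card hYZ)] at this
    have h2 : 0 ≤ 4 * q * (Fintype.card V : ℝ) ^ 2 / Λ * Wt ends w (2 * q) Y := by positivity
    linarith
  · push Not at hY
    have h1 := bad_drift ends p lam hp hlam hq hqp Y Z hYZ
    set W := Wt ends w (2 * q) Y with hWdef
    set N : ℝ := (Fintype.card V : ℝ) with hN
    have hN1 : 1 ≤ N := by rw [hN]; exact_mod_cast hn
    have h2 : ∑ x, (((cutE ends (comp ends Y x)).card : ℝ) + (comp ends Y x).card) ≤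
        N * (Real.log W + 2 * N) := by
      have : ∀ x ∈ (univ : Finset V),
          (((cutE ends (comp ends Y x)).card : ℝ) + (comp ends Y x).card) ≤
          Real.log W + 2 * N := by
        intro x _
        have h3 := cut_le_log ends hq hw hw1 x Y
        have h4 : ((comp ends Y x).card : ℝ) ≤ N := by
          rw [hN]; exact_mod_cast Finset.card_le_univ _
        have h5 : 2 * w * ((comp ends Y x).card : ℝ) ≤ (comp ends Y x).card :=
          mul_le_of_le_one_left (by positivity) (by linarith)
        linarith
      refine (Finset.sum_le_sum this).trans ?_
      rw [Finset.sum_const, nsmul_eq_mul, Finset.card_univ]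
    set r := Real.sqrt W with hr
    have hr2 : r * r = W := Real.mul_self_sqrt hW0
    have hrΛ : Λ ≤ r := Real.le_sqrt_of_sq_le hY.le
    have hr1 : 1 ≤ r := hΛ.trans hrΛ
    have hlog : Real.log W ≤ 2 * r := by
      have e1 : Real.log W = Real.log r + Real.log r := by
        rw [← hr2, Real.log_mul (by linarith) (by linarith)]
      have e2 := Real.log_le_sub_one_of_pos (show 0 < r by linarith)
      linarith
    have h3 : N * (Real.log W + 2 * N) ≤ 4 * N ^ 2 * r := by
      have e1 : Real.log W ≤ 2 * (N * r) := hlog.trans (by nlinarith)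
      have e2 : 2 * N ≤ 2 * (N * r) := by nlinarith
      have : N * (Real.log W + 2 * N) ≤ N * (2 * (N * r) + 2 * (N * r)) :=
        mul_le_mul_of_nonneg_left (by linarith) (by linarith)
      nlinarith
    have h4 : r ≤ W / Λ := by
      rw [le_div_iff₀ (by linarith), ← hr2]
      exact mul_le_mul_of_nonneg_left hrΛ (by linarith)
    have h5 : 4 * N ^ 2 * r ≤ 4 * N ^ 2 * (W / Λ) :=
      mul_le_mul_of_nonneg_left h4 (by positivity)
    have h6 := mul_le_mul_of_nonneg_left (h2.trans (h3.trans h5)) hq.le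
    have h7 : 4 * q * N ^ 2 / Λ * W = q * (4 * N ^ 2 * (W / Λ)) := by ring
    rw [h7]
    linarith

/-! ### Numerics -/

lemma numerics {n : ℕ} (hn : 3 ≤ n) {q L ε w : ℝ} (hq : 0 < q) (hL1 : L < 1)
    (hε0 : 0 < ε) (hε1 : ε ≤ 1 / 2)
    (h1 : q * Real.log n ≤ exp (-40) * exp (-(5 * Real.log (1 / ε)) / Real.log n))
    (h2 : q * Real.log n ≤ (1 - L) / 27) (hw : w = 2 * exp 1 * q) :
    q ≤ 1 / 441 ∧ w ≤ 1 / 2 ∧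
      2 * q * (Real.log (((n : ℝ) ^ 3 / ε) ^ 2) + (2 * w + 2) / (1 - L)) ≤ 1 / 2 := by
  have hn3 : (3 : ℝ) ≤ n := by exact_mod_cast hn
  have he : exp 1 < 2.7182818286 := Real.exp_one_lt_d9
  have hln : 1 ≤ Real.log n := by
    rw [Real.le_log_iff_exp_le (by linarith)]
    linarith
  have hle : 0 ≤ Real.log (1 / ε) := by
    apply Real.log_nonneg
    rw [le_div_iff₀ hε0]; linarith
  have h40 : exp (-40) ≤ 1 / 441 := by
    have : exp (20 : ℝ) ≥ 21 := by have := Real.add_one_le_exp (20 : ℝ); linarith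
    have e2 : exp (40 : ℝ) = exp 20 * exp 20 := by rw [← Real.exp_add]; norm_num
    rw [Real.exp_neg, inv_eq_one_div]
    apply one_div_le_one_div_of_le (by norm_num)
    rw [e2]; nlinarith
  set ℓ := Real.log (1 / ε) / Real.log n with hℓ
  have hℓ0 : 0 ≤ ℓ := by positivity
  have hx : -(5 * Real.log (1 / ε)) / Real.log n = -(5 * ℓ) := by rw [hℓ]; ring
  rw [hx] at h1
  have hex : exp (-(5 * ℓ)) ≤ 1 := Real.exp_le_one_iff.2 (by linarith)
  have h3 : q * Real.log n ≤ 1 / 441 :=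
    h1.trans ((mul_le_of_le_one_right (exp_pos _).le hex).trans h40)
  have h4 : q ≤ q * Real.log n := le_mul_of_one_le_right hq.le hln
  have h5 : q * Real.log (1 / ε) ≤ 1 / 441 := by
    have e1 : Real.log (1 / ε) = Real.log n * ℓ := by rw [hℓ]; field_simp
    have e2 : ℓ * exp (-(5 * ℓ)) ≤ 1 := by
      rw [Real.exp_neg, ← div_eq_mul_inv, div_le_one (exp_pos _)]
      have := Real.add_one_le_exp (5 * ℓ); linarith
    rw [e1, ← mul_assoc]
    refine (mul_le_mul_of_nonneg_right h1 hℓ0).trans ?_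
    have e3 : exp (-40) * exp (-(5 * ℓ)) * ℓ = exp (-40) * (ℓ * exp (-(5 * ℓ))) := by ring
    rw [e3]
    exact (mul_le_of_le_one_right (exp_pos _).le e2).trans h40
  have hw2 : w ≤ 1 / 8 := by rw [hw]; nlinarith
  refine ⟨by linarith, by linarith, ?_⟩
  have hlog : Real.log (((n : ℝ) ^ 3 / ε) ^ 2) = 6 * Real.log n + 2 * Real.log (1 / ε) := by
    rw [Real.log_pow, Real.log_div (by positivity) (by positivity), Real.log_pow,
      Real.log_div one_ne_zero (by positivity), Real.log_one]
    push_cast; ring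
  rw [hlog]
  have h6 : q * ((2 * w + 2) / (1 - L)) ≤ (2 * w + 2) / 27 := by
    have hL : 0 < 1 - L := by linarith
    have hqL : q / (1 - L) ≤ 1 / 27 := by
      rw [div_le_iff₀ hL]; linarith
    have hw0 : 0 < w := by rw [hw]; positivity
    have := mul_le_mul_of_nonneg_right hqL (show 0 ≤ 2 * w + 2 by linarith)
    have e : q * ((2 * w + 2) / (1 - L)) = q / (1 - L) * (2 * w + 2) := by ring
    rw [e]; linarith
  nlinarith

end GlauberProof

/-- **Lemma B.1 (rapid mixing of the Glauber dynamics at low temperature).** For a connected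
graph on `n ≥ 3` vertices and `m` edges, `p ∈ (0,1)^E`, `λ ∈ [0,1)^V`, `ε ∈ (0,1/2]` with
`(1-p_min)·log n ≤ min{e^{-40}·exp(-5·log(1/ε)/log n), (1-λ_max)/27}`, the Glauber dynamics
for `μ = μ^RC_{E,p,λ}`, started from the random initial state including each `e` independently
with probability `μ_e^E`, satisfies `d_TV(X_{T^GD}, μ) ≤ ε/2` for any
`T^GD ≥ ⌈2m(log m + log(4/ε))⌉`. -/
theorem glauber_mixing_rc {V E : Type} [Fintype V] [DecidableEq V] [Nonempty V]
    [Fintype E] [DecidableEq E] [Nonempty E]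
    [MeasurableSpace E] [MeasurableSingletonClass E]
    (ends : E → V × V) (hconn : GraphConnected ends)
    (hn : 3 ≤ Fintype.card V)
    (p : E → ℝ) (lam : V → ℝ)
    (hp : ∀ e, p e ∈ Set.Ioo (0 : ℝ) 1) (hlam : ∀ v, lam v ∈ Set.Ico (0 : ℝ) 1)
    (ε : ℝ) (hε : ε ∈ Set.Ioc (0 : ℝ) (1 / 2))
    (hlow : (1 - Finset.univ.inf' Finset.univ_nonempty p) * Real.log (Fintype.card V) ≤
      min (Real.exp (-40) *
            Real.exp (-(5 * Real.log (1 / ε)) / Real.log (Fintype.card V)))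
          ((1 - Finset.univ.sup' Finset.univ_nonempty lam) / 27))
    (TGD : ℕ)
    (hTGD : Nat.ceil (2 * (Fintype.card E : ℝ) *
        (Real.log (Fintype.card E) + Real.log (4 / ε))) ≤ TGD) :
    dTVrvDist (simMeasure (rcProb ends p lam Finset.univ) TGD)
        (fun ω : (Fin TGD → E) × (Fin TGD → ℝ) × (E → Bool) =>
          glauber (rcProb ends p lam Finset.univ) ω.1 ω.2.1 (toSet ω.2.2) TGD)
        (rcProb ends p lam Finset.univ) ≤ ε / 2 := by
  set μ := rcProb ends p lam Finset.univ with hμ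
  set q : ℝ := 1 - Finset.univ.inf' Finset.univ_nonempty p with hqdef
  set L : ℝ := Finset.univ.sup' Finset.univ_nonempty lam with hLdef
  have hqp : ∀ e, 1 - p e ≤ q := fun e => by
    have := Finset.inf'_le p (Finset.mem_univ e)
    rw [hqdef]; linarith
  have hL : ∀ v, lam v ≤ L := fun v => Finset.le_sup' lam (Finset.mem_univ v)
  have hL0 : 0 ≤ L := by
    obtain ⟨v⟩ := ‹Nonempty V›
    exact (hlam v).1.trans (hL v)
  have hL1 : L < 1 := (Finset.sup'_lt_iff _).2 fun v _ => (hlam v).2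
  have hq : 0 < q := by
    obtain ⟨e⟩ := ‹Nonempty E›
    linarith [hqp e, (hp e).2]
  obtain ⟨hε0, hε1⟩ := hε
  obtain ⟨n1, n2, n3⟩ := numerics hn hq hL1 hε0 hε1 (hlow.trans (min_le_left _ _))
    (hlow.trans (min_le_right _ _)) (w := 2 * Real.exp 1 * q) rfl
  set w := 2 * Real.exp 1 * q with hw
  have hw0 : 0 < w := by rw [hw]; positivity
  set N : ℝ := (Fintype.card V : ℝ) with hN
  have hN3 : 3 ≤ N := by rw [hN]; exact_mod_cast hn
  have hΛ : 1 ≤ N ^ 3 / ε := by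
    rw [le_div_iff₀ hε0]
    have : 1 ≤ N ^ 3 := one_le_pow₀ (by linarith)
    linarith
  have hpos := rcProb_pos ends p lam hp hlam
  have hsum := rcProb_sum ends p lam hp hlam
  rw [← hμ] at hpos hsum
  have hb : ∀ X e, 0 ≤ marg μ X e ∧ marg μ X e < 1 ∧ 1 - marg μ X e ≤ 2 * (1 - p e) :=
    fun X e => rc_marg_bounds ends p lam hp hlam X e
  have h01 : ∀ X e, 0 ≤ marg μ X e ∧ marg μ X e ≤ 1 := fun X e => ⟨(hb X e).1, (hb X e).2.1.le⟩
  have hc : ∀ X e, 1 - marg μ X e ≤ 2 * q := fun X e => by linarith [(hb X e).2.2, hqp e]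
  have hmono : ∀ Y Z e, Y ⊆ Z → marg μ Y e ≤ marg μ Z e :=
    fun Y Z e h => rc_marg_mono ends p lam hp hlam Y Z e h
  have hWnn := fun Y => Wt_nonneg (ends := ends) hw0.le (by linarith)
    (show 0 ≤ 2 * q by linarith) Y
  have htv := tv_bound hpos hsum h01 hmono
    (fun Y => 4 * q * N ^ 2 / (N ^ 3 / ε) * Wt ends w (2 * q) Y)
    (fun Y => mul_nonneg (by positivity) (hWnn Y))
    (fun Y Z h => drift ends p lam hp hlam hq hqp hL hL0 hL1 (by omega) hw n2 hΛ n3 Y Z h)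
    (prW (marg μ Finset.univ) (fun e => 1 - marg μ Finset.univ e))
    (prW_nonneg (fun e => (h01 _ e).1) (fun e => by linarith [(h01 Finset.univ e).2]))
    (by rw [prW_sum]; simp)
    (dom_pr hpos hsum hmono (fun X e => ⟨(hb X e).1, (hb X e).2.1⟩)) TGD
  have hβ : 2 * ∑ Y, μ Y * (4 * q * N ^ 2 / (N ^ 3 / ε) * Wt ends w (2 * q) Y) ≤ ε / 4 := by
    have e1 : ∑ Y, μ Y * (4 * q * N ^ 2 / (N ^ 3 / ε) * Wt ends w (2 * q) Y) =
        4 * q * N ^ 2 / (N ^ 3 / ε) * ∑ Y, μ Y * Wt ends w (2 * q) Y := by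
      rw [Finset.mul_sum]
      exact Finset.sum_congr rfl fun Y _ => by ring
    have e2 := Wt_exp hpos hsum (show 0 < 2 * q by linarith) hc hw0.le (by linarith) ends
    have e3 := mul_le_mul_of_nonneg_left e2
      (show 0 ≤ 4 * q * N ^ 2 / (N ^ 3 / ε) by positivity)
    have e4 : 4 * q * N ^ 2 / (N ^ 3 / ε) * (Fintype.card V : ℝ) = 4 * q * ε := by
      rw [← hN]; field_simp
    rw [e1]
    rw [e4] at e3
    nlinarith
  have hT : (1 - 1 / (2 * (Fintype.card E : ℝ))) ^ TGD * Fintype.card E ≤ ε / 4 := by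
    set m : ℝ := (Fintype.card E : ℝ) with hm
    have hm1 : 1 ≤ m := by rw [hm]; exact_mod_cast Fintype.card_pos
    have hT1 : 2 * m * (Real.log m + Real.log (4 / ε)) ≤ TGD :=
      (Nat.le_ceil _).trans (by exact_mod_cast hTGD)
    have e1 : 1 - 1 / (2 * m) ≤ Real.exp (-(1 / (2 * m))) := Real.one_sub_le_exp_neg _
    have e0 : 0 ≤ 1 - 1 / (2 * m) := by
      rw [sub_nonneg, div_le_one (by linarith)]; linarith
    have e2 := pow_le_pow_left₀ e0 e1 TGD
    rw [← Real.exp_nat_mul] at e2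
    have e3 : (TGD : ℝ) * -(1 / (2 * m)) ≤ -(Real.log m + Real.log (4 / ε)) := by
      have : Real.log m + Real.log (4 / ε) ≤ TGD / (2 * m) := by
        rw [le_div_iff₀ (by linarith)]; linarith
      have e : (TGD : ℝ) * -(1 / (2 * m)) = -(TGD / (2 * m)) := by ring
      rw [e]; linarith
    have e4 := e2.trans (Real.exp_le_exp.2 e3)
    have e5 : Real.exp (-(Real.log m + Real.log (4 / ε))) * m = ε / 4 := by
      rw [← Real.log_mul (by positivity) (by positivity), Real.exp_neg,
        Real.exp_log (by positivity)]
      field_simp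
    rw [← e5]
    exact mul_le_mul_of_nonneg_right e4 (by linarith)
  unfold dTVrvDist
  simp_rw [sim_law h01]
  refine htv.trans ?_
  linarith
end
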